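/- arXiv:1601.00390 — 3 statements merged into one kernel-verified Lean document; each statement's English description precedes it below -/
import Mathlib

section
/- Let Ω ⊂ ℝⁿ be a bounded open set, let u : ℝⁿ → ℝⁿ be continuously differentiable, and let φ : ℝⁿ → ℝⁿ be continuously differentiable with compact support contained in Ω. Then ∫_Ω det(∇u(x) + ∇φ(x)) dx = ∫_Ω det ∇u(x) dx. (The determinant is a null Lagrangian of the first order.) -/
open MeasureTheory Filter Topology Metric Bornology
open scoped ENNReal NNReal

noncomputable section

/-- The gradient of a map `u : ℝⁿ → ℝⁿ`, identified with an `n × n` matrix. -/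
def grad {n : ℕ} (u : EuclideanSpace ℝ (Fin n) → EuclideanSpace ℝ (Fin n))
    (x : EuclideanSpace ℝ (Fin n)) : Matrix (Fin n) (Fin n) ℝ :=
  Matrix.of fun i j => fderiv ℝ u x (EuclideanSpace.single j 1) i

theorem grad_eq_toMatrix {n : ℕ} (u : EuclideanSpace ℝ (Fin n) → EuclideanSpace ℝ (Fin n))
    (x : EuclideanSpace ℝ (Fin n)) :
    grad u x = LinearMap.toMatrix (EuclideanSpace.basisFun (Fin n) ℝ).toBasis
      (EuclideanSpace.basisFun (Fin n) ℝ).toBasis (fderiv ℝ u x : _ →ₗ[ℝ] _) := by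
  ext i j
  simp [grad, LinearMap.toMatrix_apply]

theorem det_grad_comb {n : ℕ} (u : EuclideanSpace ℝ (Fin n) → EuclideanSpace ℝ (Fin n))
    (x : EuclideanSpace ℝ (Fin n)) (t : ℝ) :
    (t • grad u x + 1).det =
      (ContinuousLinearMap.id ℝ (EuclideanSpace ℝ (Fin n)) + t • fderiv ℝ u x).det := by
  rw [ContinuousLinearMap.det,
    ← LinearMap.det_toMatrix (EuclideanSpace.basisFun (Fin n) ℝ).toBasis, grad_eq_toMatrix]
  congr 1
  simp only [ContinuousLinearMap.toLinearMap_add, ContinuousLinearMap.toLinearMap_smul, map_add,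
    map_smul, ContinuousLinearMap.coe_id, LinearMap.toMatrix_id]
  rw [add_comm]

theorem continuous_grad {n : ℕ} {u : EuclideanSpace ℝ (Fin n) → EuclideanSpace ℝ (Fin n)}
    (hu : ContDiff ℝ 1 u) : Continuous (grad u) := by
  have h := hu.continuous_fderiv (by simp)
  refine continuous_matrix fun i j => ?_
  simp only [grad, Matrix.of_apply]
  fun_prop

theorem grad_eq_zero {n : ℕ} {u : EuclideanSpace ℝ (Fin n) → EuclideanSpace ℝ (Fin n)}
    {x : EuclideanSpace ℝ (Fin n)} (hx : x ∉ tsupport u) : grad u x = 0 := by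
  have : fderiv ℝ u x = 0 := by
    by_contra h
    exact hx (support_fderiv_subset ℝ h)
  ext i j
  simp [grad, this]

/-- Leading coefficient extraction by interpolation. -/
theorem exists_weights (n : ℕ) (hn : 0 < n) (ε : ℝ) (hε : 0 < ε) :
    ∃ v w : ℕ → ℝ, (∀ i ∈ Finset.range (n + 1), 0 < v i ∧ v i < ε) ∧
      (∀ A : Matrix (Fin n) (Fin n) ℝ,
        A.det = ∑ i ∈ Finset.range (n + 1), w i * (v i • A + 1).det) ∧
      ∑ i ∈ Finset.range (n + 1), w i = 0 := by
  set v : ℕ → ℝ := fun i => ε / (i + 2) with hv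
  have hinj : Set.InjOn v (Finset.range (n + 1) : Finset ℕ) := by
    intro i _ j _ hij
    simp only [hv] at hij
    rw [div_eq_div_iff (by positivity) (by positivity)] at hij
    have := mul_left_cancel₀ hε.ne' hij
    have h2 : (i : ℝ) = j := by linarith
    exact_mod_cast h2
  have key : ∀ A : Matrix (Fin n) (Fin n) ℝ,
      A.det = ∑ i ∈ Finset.range (n + 1),
        (∏ j ∈ (Finset.range (n + 1)).erase i, (v i - v j))⁻¹ * (v i • A + 1).det := by
    intro A
    have h1 := Polynomial.coeff_det_X_add_C_card A 1
    have h2 := Polynomial.natDegree_det_X_add_C_le A 1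
    rw [Fintype.card_fin] at h1 h2
    have h3 := Lagrange.coeff_eq_sum hinj
      (P := Matrix.det ((Polynomial.X : Polynomial ℝ) • A.map Polynomial.C
        + (1 : Matrix (Fin n) (Fin n) ℝ).map Polynomial.C)) (by
        rw [Finset.card_range]
        exact Polynomial.degree_le_natDegree.trans_lt (by exact_mod_cast Nat.lt_succ_of_le h2))
    rw [Finset.card_range, Nat.add_sub_cancel, h1] at h3
    rw [h3]
    refine Finset.sum_congr rfl fun i _ => ?_
    rw [div_eq_inv_mul]
    congr 1
    rw [← Polynomial.coe_evalRingHom, RingHom.map_det]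
    congr 1
    ext a b
    have hone : Polynomial.eval (v i) (if a = b then (1 : Polynomial ℝ) else 0)
        = if a = b then (1 : ℝ) else 0 := by
      split_ifs <;> simp
    simp [Matrix.map_apply, Matrix.one_apply, hone]
    exact mul_comm _ _
  refine ⟨v, fun i => (∏ j ∈ (Finset.range (n + 1)).erase i, (v i - v j))⁻¹, ?_, key, ?_⟩
  · intro i _
    refine ⟨by positivity, ?_⟩
    simp only [hv]
    rw [div_lt_iff₀ (by positivity)]
    have : (0 : ℝ) ≤ i := by positivity
    nlinarith
  · have key0 := key 0
    have : Nonempty (Fin n) := ⟨⟨0, hn⟩⟩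
    simpa [Matrix.det_zero] using key0.symm

theorem exists_eps {n : ℕ} {F : EuclideanSpace ℝ (Fin n) → EuclideanSpace ℝ (Fin n)}
    (hF : ContDiff ℝ 1 F) (hc : HasCompactSupport F) (R : ℝ)
    (hR : tsupport F ⊆ ball 0 R) :
    ∃ ε > 0, ∀ t : ℝ, 0 < t → t < ε →
      ∫ x in ball (0 : EuclideanSpace ℝ (Fin n)) R, (t • grad F x + 1).det
        = volume.real (ball (0 : EuclideanSpace ℝ (Fin n)) R) := by
  obtain ⟨K, hK⟩ := hF.lipschitzWith_of_hasCompactSupport hc (by simp)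
  let E := EuclideanSpace ℝ (Fin n)
  have hdet : ∀ᶠ A in 𝓝 (ContinuousLinearMap.id ℝ E), 0 < A.det := by
    have h1 : ContinuousAt (fun A : E →L[ℝ] E => A.det) (ContinuousLinearMap.id ℝ E) :=
      ContinuousLinearMap.continuous_det.continuousAt
    refine h1.eventually (lt_mem_nhds ?_)
    simp [ContinuousLinearMap.det]
  obtain ⟨δ, hδ, hδ'⟩ := Metric.eventually_nhds_iff.1 hdet
  refine ⟨min δ 1 / (K + 1), by positivity, fun t ht0 ht => ?_⟩
  rw [lt_div_iff₀ (by positivity)] at ht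
  have htK : t * K < min δ 1 := by nlinarith
  have ht1 : t * K < 1 := htK.trans_le (min_le_right _ _)
  have htδ : t * K < δ := htK.trans_le (min_le_left _ _)
  set f : E → E := fun x => x + t • F x with hf
  have hfd : ∀ x, HasFDerivAt f (ContinuousLinearMap.id ℝ E + t • fderiv ℝ F x) x := fun x =>
    (hasFDerivAt_id x).add (((hF.differentiable (by simp)) x).hasFDerivAt.const_smul t)
  have happ : ApproximatesLinearOn f ((ContinuousLinearEquiv.refl ℝ E : E ≃L[ℝ] E) : E →L[ℝ] E)
      Set.univ ⟨t * K, by positivity⟩ := by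
    intro x _ y _
    have h1 : f x - f y - ((ContinuousLinearEquiv.refl ℝ E : E ≃L[ℝ] E) : E →L[ℝ] E) (x - y)
        = t • (F x - F y) := by
      simp only [hf, ContinuousLinearEquiv.coe_refl, ContinuousLinearMap.coe_id', id, smul_sub]
      abel
    rw [h1, norm_smul, Real.norm_of_nonneg ht0.le]
    have := hK.norm_sub_le x y
    calc t * ‖F x - F y‖ ≤ t * (K * ‖x - y‖) := by gcongr
      _ = _ := by rw [← mul_assoc]; rfl
  have hcond : Subsingleton E ∨ (⟨t * K, by positivity⟩ : ℝ≥0) <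
      ‖((ContinuousLinearEquiv.refl ℝ E).symm : E →L[ℝ] E)‖₊⁻¹ := by
    rcases subsingleton_or_nontrivial E with h | h
    · exact Or.inl h
    · right
      have : ‖((ContinuousLinearEquiv.refl ℝ E).symm : E →L[ℝ] E)‖₊ = 1 := by
        simp
      rw [this, inv_one]
      exact_mod_cast ht1
  have hinj : Function.Injective f := Set.injOn_univ.1 (happ.injOn hcond)
  have hsurj : Function.Surjective f := happ.surjective hcond
  have hout : ∀ x, x ∉ ball (0 : E) R → f x = x := by
    intro x hx
    have : F x = 0 := image_eq_zero_of_notMem_tsupport (fun h => hx (hR h))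
    simp [hf, this]
  have himg : f '' ball (0 : E) R = ball (0 : E) R := by
    ext y
    constructor
    · rintro ⟨x, hx, rfl⟩
      by_contra h
      have := hinj (hout _ h)
      rw [this] at h
      exact h hx
    · intro hy
      obtain ⟨x, rfl⟩ := hsurj y
      refine ⟨x, ?_, rfl⟩
      by_contra h
      rw [hout x h] at hy
      exact h hy
  have hcv := integral_image_eq_integral_abs_det_fderiv_smul (volume : Measure E)
    (s := ball (0 : E) R) measurableSet_ball
    (fun x _ => (hfd x).hasFDerivWithinAt) hinj.injOn (fun _ => (1 : ℝ))
  rw [himg] at hcv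
  have hpos : ∀ x, 0 < (ContinuousLinearMap.id ℝ E + t • fderiv ℝ F x).det := by
    intro x
    apply hδ'
    rw [dist_eq_norm, add_sub_cancel_left, norm_smul, Real.norm_of_nonneg ht0.le]
    have := norm_fderiv_le_of_lipschitz ℝ hK (x₀ := x)
    exact lt_of_le_of_lt (by gcongr) htδ
  simp only [abs_of_pos (hpos _), smul_eq_mul, mul_one] at hcv
  have hcomb : (fun x => (t • grad F x + 1).det) = fun x =>
      (ContinuousLinearMap.id ℝ E + t • fderiv ℝ F x).det := funext fun x => det_grad_comb F x t
  rw [hcomb]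
  refine hcv.symm.trans ?_
  simp [E]

theorem integral_det_grad_eq_zero {n : ℕ} (hn : 0 < n)
    {F : EuclideanSpace ℝ (Fin n) → EuclideanSpace ℝ (Fin n)}
    (hF : ContDiff ℝ 1 F) (hc : HasCompactSupport F) :
    ∫ x, (grad F x).det = 0 := by
  obtain ⟨R, hR⟩ := hc.isCompact.isBounded.subset_ball 0
  obtain ⟨ε, hε, h⟩ := exists_eps hF hc R hR
  obtain ⟨v, w, hv, hw, hs⟩ := exists_weights n hn ε hε
  have hcont := continuous_grad hF
  have : Nonempty (Fin n) := ⟨⟨0, hn⟩⟩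
  rw [← setIntegral_eq_integral_of_forall_compl_eq_zero (s := ball 0 R)]
  · simp_rw [hw (grad F _)]
    rw [integral_finsetSum]
    · simp_rw [integral_const_mul]
      rw [Finset.sum_congr rfl fun i hi => by rw [h (v i) (hv i hi).1 (hv i hi).2],
        ← Finset.sum_mul, hs, zero_mul]
    · intro i _
      have hc1 : Continuous fun x => w i * (v i • grad F x + 1).det := by fun_prop
      exact (hc1.continuousOn.integrableOn_compact (isCompact_closedBall 0 R)).mono_set
        ball_subset_closedBall
  · intro x hx
    rw [grad_eq_zero (fun h => hx (hR h)), Matrix.det_zero]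

theorem integrable_det_grad {n : ℕ} (hn : 0 < n)
    {F : EuclideanSpace ℝ (Fin n) → EuclideanSpace ℝ (Fin n)}
    (hF : ContDiff ℝ 1 F) (hc : HasCompactSupport F) :
    Integrable fun x => (grad F x).det := by
  have : Nonempty (Fin n) := ⟨⟨0, hn⟩⟩
  have hcont := continuous_grad hF
  have h1 : Continuous fun x => (grad F x).det := by fun_prop
  refine h1.integrable_of_hasCompactSupport ?_
  refine HasCompactSupport.intro hc.isCompact fun x hx => ?_
  rw [grad_eq_zero hx, Matrix.det_zero]

theorem grad_add {n : ℕ} {u v : EuclideanSpace ℝ (Fin n) → EuclideanSpace ℝ (Fin n)}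
    (hu : ContDiff ℝ 1 u) (hv : ContDiff ℝ 1 v) (x : EuclideanSpace ℝ (Fin n)) :
    grad (u + v) x = grad u x + grad v x := by
  ext i j
  simp only [grad, Matrix.of_apply, Matrix.add_apply]
  rw [fderiv_add ((hu.differentiable (by simp)) x) ((hv.differentiable (by simp)) x)]
  simp

/-- The determinant is a null Lagrangian of the first order: for every bounded open
`Ω ⊆ ℝⁿ`, every `C¹` map `u : ℝⁿ → ℝⁿ` and every `C¹` map `φ` with compact support
contained in `Ω`, `∫_Ω det(∇u + ∇φ) = ∫_Ω det ∇u`. -/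
theorem stmt6 {n : ℕ} (Ω : Set (EuclideanSpace ℝ (Fin n)))
    (hΩo : IsOpen Ω) (hΩb : Bornology.IsBounded Ω)
    (u φ : EuclideanSpace ℝ (Fin n) → EuclideanSpace ℝ (Fin n))
    (hu : ContDiff ℝ 1 u) (hφ : ContDiff ℝ 1 φ)
    (hcs : HasCompactSupport φ) (hsupp : tsupport φ ⊆ Ω) :
    ∫ x in Ω, (grad u x + grad φ x).det = ∫ x in Ω, (grad u x).det := by
  rcases Nat.eq_zero_or_pos n with rfl | hn
  · simp
  obtain ⟨R, hR⟩ := hΩb.subset_ball (0 : EuclideanSpace ℝ (Fin n))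
  let χ : ContDiffBump (0 : EuclideanSpace ℝ (Fin n)) :=
    { rIn := max R 1, rOut := max R 1 + 1, rIn_pos := by positivity, rIn_lt_rOut := by simp }
  set w : EuclideanSpace ℝ (Fin n) → EuclideanSpace ℝ (Fin n) := fun x => χ x • u x with hw
  have hwC : ContDiff ℝ 1 w := χ.contDiff.smul hu
  have hwc : HasCompactSupport w := χ.hasCompactSupport.smul_right
  have hwu : ∀ x ∈ Ω, grad w x = grad u x := by
    intro x hx
    have h1 : w =ᶠ[𝓝 x] u := by
      filter_upwards [hΩo.mem_nhds hx] with y hy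
      have : χ y = 1 := χ.one_of_mem_closedBall
        (ball_subset_closedBall (ball_subset_ball (le_max_left R 1) (hR hy)))
      simp [hw, this]
    ext i j
    simp only [grad, h1.fderiv_eq]
  have h1 := integral_det_grad_eq_zero hn hwC hwc
  have h2 := integral_det_grad_eq_zero hn (hwC.add hφ) (hwc.add hcs)
  have i1 := integrable_det_grad hn hwC hwc
  have i2 := integrable_det_grad hn (hwC.add hφ) (hwc.add hcs)
  have hm := hΩo.measurableSet
  rw [← integral_add_compl hm i1] at h1
  rw [← integral_add_compl hm i2] at h2
  have h3 : ∫ x in Ωᶜ, (grad (w + φ) x).det = ∫ x in Ωᶜ, (grad w x).det := by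
    refine setIntegral_congr_fun hm.compl fun x hx => ?_
    simp only [grad_add hwC hφ, grad_eq_zero (fun h => hx (hsupp h)), add_zero]
  have h4 : ∫ x in Ω, (grad (w + φ) x).det = ∫ x in Ω, (grad u x + grad φ x).det := by
    refine setIntegral_congr_fun hm fun x hx => ?_
    simp only [grad_add hwC hφ, hwu x hx]
  have h5 : ∫ x in Ω, (grad w x).det = ∫ x in Ω, (grad u x).det := by
    refine setIntegral_congr_fun hm fun x hx => ?_
    simp only [hwu x hx]
  change (∫ x in Ω, (grad (w + φ) x).det) + ∫ x in Ωᶜ, (grad (w + φ) x).det = 0 at h2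
  linarith
end
end

section
/- Let Ω ⊂ ℝⁿ be a bounded open set and let {u_k} be a sequence of maps u_k : Ω → ℝⁿ that are Lipschitz with a common Lipschitz constant ℓ and converge uniformly on Ω to a map u (which is then ℓ-Lipschitz). Then for every g ∈ L¹(Ω): ∫_Ω g(x) det ∇u_k(x) dx → ∫_Ω g(x) det ∇u(x) dx as k → ∞. (Weak* continuity of the determinant, an instance of the weak* sequential continuity of null Lagrangians on W^{1,∞}.) -/
open MeasureTheory Filter Topology Metric Bornology
open scoped ENNReal NNReal

noncomputable section

/-- Images of null sets under Lipschitz maps are null. -/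
lemma lip_image_null {n : ℕ} {K : ℝ≥0} {f : EuclideanSpace ℝ (Fin n) → EuclideanSpace ℝ (Fin n)}
    (hf : LipschitzWith K f) {s : Set (EuclideanSpace ℝ (Fin n))} (hs : volume s = 0) :
    volume (f '' s) = 0 := by
  have h1 : (Measure.hausdorffMeasure (Module.finrank ℝ (EuclideanSpace ℝ (Fin n))) :
      Measure (EuclideanSpace ℝ (Fin n))) ≪ volume :=
    Measure.absolutelyContinuous_isAddHaarMeasure _ _
  have h2 : (volume : Measure (EuclideanSpace ℝ (Fin n))) ≪
      (Measure.hausdorffMeasure (Module.finrank ℝ (EuclideanSpace ℝ (Fin n)))) :=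
    Measure.absolutelyContinuous_isAddHaarMeasure _ _
  apply h2
  have := hf.hausdorffMeasure_image_le
    (d := Module.finrank ℝ (EuclideanSpace ℝ (Fin n))) (by positivity) s
  rw [h1 hs, mul_zero] at this
  exact nonpos_iff_eq_zero.1 this

/-- Perturbations of the identity of norm `< 1` have positive determinant. -/
lemma det_one_add_pos {E : Type*} [NormedAddCommGroup E] [NormedSpace ℝ E] [FiniteDimensional ℝ E]
    (A : E →L[ℝ] E) (hA : ‖A‖ < 1) : 0 < (1 + A).det := by
  have hne : ∀ t ∈ Set.Icc (0:ℝ) 1, (1 + t • A).det ≠ 0 := by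
    intro t ht h0
    have hu : IsUnit (1 + t • A) := by
      have hlt : ‖-(t • A)‖ < 1 := by
        rw [norm_neg, norm_smul, Real.norm_of_nonneg ht.1]
        nlinarith [norm_nonneg A, ht.2]
      have := isUnit_one_sub_of_norm_lt_one hlt
      rwa [sub_neg_eq_add] at this
    have h3 : IsUnit ((1 + t • A : E →L[ℝ] E) : E →ₗ[ℝ] E) :=
      hu.map (ContinuousLinearMap.toLinearMapRingHom (R₁ := ℝ) (M₁ := E))
    have h4 := h3.map (LinearMap.det (M := E) (A := ℝ))
    exact h4.ne_zero h0
  have hc : ContinuousOn (fun t : ℝ => (1 + t • A).det) (Set.Icc 0 1) := by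
    apply Continuous.continuousOn
    exact ContinuousLinearMap.continuous_det.comp (by fun_prop)
  by_contra hneg
  push Not at hneg
  have := intermediate_value_Icc' (zero_le_one (α := ℝ)) hc
  have h0 : (0:ℝ) ∈ Set.Icc ((1 + (1:ℝ) • A).det) ((1 + (0:ℝ) • A).det) := by
    constructor
    · simpa using hneg
    · simp [ContinuousLinearMap.det]
  obtain ⟨t, ht, h⟩ := this h0
  exact hne t ht h

/-- Volume preservation for a perturbation of the identity supported in a ball. -/
lemma integral_det_one_add {n : ℕ} {K : ℝ≥0} (hK : K < 1)
    {w : EuclideanSpace ℝ (Fin n) → EuclideanSpace ℝ (Fin n)}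
    (hw : LipschitzWith K w) {R : ℝ} (h0 : ∀ x, x ∉ closedBall (0 : EuclideanSpace ℝ (Fin n)) R → w x = 0) :
    ∫ x in closedBall (0 : EuclideanSpace ℝ (Fin n)) R, (1 + fderiv ℝ w x).det =
      volume.real (closedBall (0 : EuclideanSpace ℝ (Fin n)) R) := by
  set B := closedBall (0 : EuclideanSpace ℝ (Fin n)) R with hB
  set f : EuclideanSpace ℝ (Fin n) → EuclideanSpace ℝ (Fin n) := fun x => x + w x with hf
  have happ : ApproximatesLinearOn f
      ((ContinuousLinearEquiv.refl ℝ (EuclideanSpace ℝ (Fin n))) :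
        EuclideanSpace ℝ (Fin n) →L[ℝ] EuclideanSpace ℝ (Fin n)) Set.univ K := by
    intro x _ y _
    have := hw.dist_le_mul x y
    rw [dist_eq_norm, dist_eq_norm] at this
    have e : (x + w x) - (y + w y) - (x - y) = w x - w y := by abel
    rw [← e] at this
    exact this
  have hc : Subsingleton (EuclideanSpace ℝ (Fin n)) ∨
      K < ‖((ContinuousLinearEquiv.refl ℝ (EuclideanSpace ℝ (Fin n))).symm :
        EuclideanSpace ℝ (Fin n) →L[ℝ] EuclideanSpace ℝ (Fin n))‖₊⁻¹ := by
    rcases subsingleton_or_nontrivial (EuclideanSpace ℝ (Fin n)) with h | h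
    · exact Or.inl h
    · right
      have : ‖((ContinuousLinearEquiv.refl ℝ (EuclideanSpace ℝ (Fin n))).symm :
        EuclideanSpace ℝ (Fin n) →L[ℝ] EuclideanSpace ℝ (Fin n))‖₊ = 1 := by
        ext
        exact ContinuousLinearMap.norm_id
      rw [this]; simpa using hK
  have hinj : Function.Injective f := Set.injOn_univ.1 (happ.injOn hc)
  have hsurj : Function.Surjective f := happ.surjective hc
  have himg : f '' B = B := by
    have hout : ∀ x, x ∉ B → f x = x := fun x hx => by simp [hf, h0 x hx]
    ext y
    constructor
    · rintro ⟨x, hx, rfl⟩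
      by_contra hy
      exact hy ((hinj (hout _ hy)).symm ▸ hx)
    · intro hy
      obtain ⟨x, rfl⟩ := hsurj y
      refine ⟨x, ?_, rfl⟩
      by_contra hx
      rw [hout x hx] at hy
      exact hx hy
  have hfl : LipschitzWith (1 + K) f := LipschitzWith.id.add hw
  set D := {x | DifferentiableAt ℝ w x} with hD
  have hDm : MeasurableSet D := measurableSet_of_differentiableAt ℝ w
  have hDn : volume Dᶜ = 0 := by
    have := hw.ae_differentiableAt (μ := volume)
    exact this
  have hBm : MeasurableSet B := measurableSet_closedBall
  have hcv := lintegral_abs_det_fderiv_eq_addHaar_image (μ := volume) (f := f)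
    (f' := fun x => 1 + fderiv ℝ w x) (s := B ∩ D) (hBm.inter hDm)
    (fun x hx => by
      have := (hasFDerivAt_id x).add (DifferentiableAt.hasFDerivAt hx.2)
      exact this.hasFDerivWithinAt) hinj.injOn
  have hvol : volume (f '' (B ∩ D)) = volume B := by
    apply le_antisymm
    · rw [← himg]
      exact measure_mono (Set.image_mono (by rw [himg]; exact Set.inter_subset_left))
    · calc volume B = volume (f '' B) := by rw [himg]
        _ ≤ volume (f '' (B ∩ D) ∪ f '' Dᶜ) := by
          apply measure_mono
          rw [← Set.image_union]
          apply Set.image_mono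
          intro x hx
          by_cases h : x ∈ D
          · exact Or.inl ⟨hx, h⟩
          · exact Or.inr h
        _ ≤ volume (f '' (B ∩ D)) + volume (f '' Dᶜ) := measure_union_le _ _
        _ = _ := by rw [lip_image_null hfl hDn, add_zero]
  have hpos : ∀ x, 0 < (1 + fderiv ℝ w x).det := fun x =>
    det_one_add_pos _ (lt_of_le_of_lt (norm_fderiv_le_of_lipschitz ℝ hw) (by exact_mod_cast hK))
  rw [hvol] at hcv
  have hae : (B ∩ D : Set _) =ᵐ[volume] B := by
    have : D =ᵐ[volume] Set.univ := ae_eq_univ.2 hDn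
    simpa using (ae_eq_refl B).inter this
  rw [Measure.restrict_congr_set hae] at hcv
  rw [integral_eq_lintegral_of_nonneg_ae (ae_of_all _ fun x => (hpos x).le)]
  · simp_rw [abs_of_pos (hpos _)] at hcv
    rw [hcv]; rfl
  · have hm : Measurable fun x => 1 + fderiv ℝ w x := (measurable_fderiv ℝ w).const_add _
    exact (ContinuousLinearMap.continuous_det.measurable.comp hm).aestronglyMeasurable

/-- The matrix of gradients of a family of scalar functions. -/
def jm {n : ℕ} (f : Fin n → EuclideanSpace ℝ (Fin n) → ℝ)
    (x : EuclideanSpace ℝ (Fin n)) : Matrix (Fin n) (Fin n) ℝ :=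
  Matrix.of fun i j => fderiv ℝ (f i) x (EuclideanSpace.single j 1)

lemma grad_eq_jm {n : ℕ} {u : EuclideanSpace ℝ (Fin n) → EuclideanSpace ℝ (Fin n)}
    {x : EuclideanSpace ℝ (Fin n)} (h : DifferentiableAt ℝ u x) :
    grad u x = jm (fun i y => u y i) x := by
  ext i j
  have h2 := ((EuclideanSpace.proj (𝕜 := ℝ) i).hasFDerivAt.comp x h.hasFDerivAt).fderiv
  have h3 : (EuclideanSpace.proj (𝕜 := ℝ) i : EuclideanSpace ℝ (Fin n) →L[ℝ] ℝ) ∘ u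
    = fun y => u y i := rfl
  rw [h3] at h2
  simp only [jm, grad, Matrix.of_apply, h2]
  rfl

lemma det_one_add_smul_fderiv {n : ℕ} (u : EuclideanSpace ℝ (Fin n) → EuclideanSpace ℝ (Fin n))
    (x : EuclideanSpace ℝ (Fin n)) (t : ℝ) :
    (1 + t • fderiv ℝ u x).det = (1 + t • grad u x).det := by
  have h : LinearMap.toMatrix (EuclideanSpace.basisFun (Fin n) ℝ).toBasis
      (EuclideanSpace.basisFun (Fin n) ℝ).toBasis
      ((1 + t • fderiv ℝ u x : EuclideanSpace ℝ (Fin n) →L[ℝ] EuclideanSpace ℝ (Fin n)) :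
        EuclideanSpace ℝ (Fin n) →ₗ[ℝ] EuclideanSpace ℝ (Fin n)) = 1 + t • grad u x := by
    ext i j
    simp [LinearMap.toMatrix_apply, grad, Matrix.one_apply]
  rw [← h, LinearMap.det_toMatrix]

lemma jm_entry_le {n : ℕ} {f : Fin n → EuclideanSpace ℝ (Fin n) → ℝ} {K : ℝ≥0}
    (hf : ∀ i, LipschitzWith K (f i)) (x : EuclideanSpace ℝ (Fin n)) (i j : Fin n) :
    |jm f x i j| ≤ K := by
  have h1 := (fderiv ℝ (f i) x).le_opNorm (EuclideanSpace.single j (1:ℝ))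
  have h2 := norm_fderiv_le_of_lipschitz ℝ (hf i) (x₀ := x)
  simp only [PiLp.norm_single, norm_one, mul_one] at h1
  exact h1.trans h2

lemma det_jm_le {n : ℕ} {f : Fin n → EuclideanSpace ℝ (Fin n) → ℝ} {K : ℝ≥0}
    (hf : ∀ i, LipschitzWith K (f i)) (x : EuclideanSpace ℝ (Fin n)) :
    |(jm f x).det| ≤ (n.factorial : ℝ) * (K : ℝ) ^ n := by
  have := Matrix.det_le (A := jm f x) (abv := AbsoluteValue.abs) (x := (K:ℝ))
    (fun i j => jm_entry_le hf x i j)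
  simpa using this

lemma measurable_det_jm {n : ℕ} (f : Fin n → EuclideanSpace ℝ (Fin n) → ℝ) :
    Measurable fun x => (jm f x).det := by
  simp only [Matrix.det_apply']
  refine Finset.measurable_sum _ fun σ _ => ?_
  refine Measurable.const_mul ?_ _
  refine Finset.measurable_prod _ fun i _ => ?_
  exact measurable_fderiv_apply_const ℝ _ _

lemma exists_common_lip {n : ℕ} {f : Fin n → EuclideanSpace ℝ (Fin n) → ℝ}
    (hf : ∀ i, ∃ K, LipschitzWith K (f i)) : ∃ K, ∀ i, LipschitzWith K (f i) := by
  choose K hK using hf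
  exact ⟨∑ i, K i, fun i => (hK i).weaken
    (Finset.single_le_sum (f := K) (fun _ _ => zero_le) (Finset.mem_univ i))⟩

/-- The null Lagrangian property for compactly supported families. -/
lemma integral_det_jm_zero_aux {n : ℕ} (hn : 0 < n) {f : Fin n → EuclideanSpace ℝ (Fin n) → ℝ}
    {K : ℝ≥0} (hf : ∀ i, LipschitzWith K (f i)) {R : ℝ}
    (h0 : ∀ i x, x ∉ closedBall (0 : EuclideanSpace ℝ (Fin n)) R → f i x = 0) :
    ∫ x in closedBall (0 : EuclideanSpace ℝ (Fin n)) R, (jm f x).det = 0 := by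
  set w : EuclideanSpace ℝ (Fin n) → EuclideanSpace ℝ (Fin n) :=
    fun x => WithLp.toLp 2 (fun i => f i x) with hw
  obtain ⟨L, hL⟩ : ∃ L, LipschitzWith L w := by
    have h1 : LipschitzWith K (fun x => fun i => f i x) := LipschitzWith.of_dist_le_mul fun x y => by
      rw [dist_pi_le_iff (by positivity)]
      exact fun i => (hf i).dist_le_mul x y
    exact ⟨_, (PiLp.lipschitzWith_toLp 2 (fun _ : Fin n => ℝ)).comp h1⟩
  have hw0 : ∀ x, x ∉ closedBall (0 : EuclideanSpace ℝ (Fin n)) R → w x = 0 := by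
    intro x hx
    ext i
    exact h0 i x hx
  have hdw : ∀ᵐ x, DifferentiableAt ℝ w x := hL.ae_differentiableAt
  -- the nodes
  set v : ℕ → ℝ := fun k => (k : ℝ) / ((n + 1) * (L + 1)) with hv
  have hL0 : (0:ℝ) ≤ L := L.2
  have hvinj : Set.InjOn v (Finset.range (n + 1)) := by
    intro a _ b _ hab
    have hpos : (0:ℝ) < (n + 1) * (L + 1) := by positivity
    simp only [hv] at hab
    rw [div_left_inj' hpos.ne'] at hab
    exact_mod_cast hab
  have hB : ∀ k ∈ Finset.range (n + 1),
      ∫ x in closedBall (0 : EuclideanSpace ℝ (Fin n)) R, (1 + v k • jm f x).det =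
        volume.real (closedBall (0 : EuclideanSpace ℝ (Fin n)) R) := by
    intro k hk
    have hk' : (k:ℝ) ≤ n := by
      have := Finset.mem_range.1 hk
      exact_mod_cast Nat.lt_succ_iff.1 this
    have hlip : LipschitzWith (‖v k‖₊ * L) (v k • w) := by
      apply LipschitzWith.of_dist_le_mul
      intro x y
      have := hL.dist_le_mul x y
      simp only [Pi.smul_apply, dist_smul₀, NNReal.coe_mul, coe_nnnorm]
      rw [mul_assoc]
      gcongr
    have hlt : ‖v k‖₊ * L < 1 := by
      rw [← NNReal.coe_lt_coe]
      have hvk : (0:ℝ) ≤ v k := by simp only [hv]; positivity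
      rw [NNReal.coe_mul, coe_nnnorm, Real.norm_of_nonneg hvk, NNReal.coe_one, hv]
      rw [div_mul_eq_mul_div, div_lt_one (by positivity)]
      nlinarith
    have := integral_det_one_add hlt hlip (R := R) (fun x hx => by simp [hw0 x hx])
    rw [← this]
    apply integral_congr_ae
    apply ae_restrict_of_ae
    filter_upwards [hdw] with x hx
    have hgj : grad w x = jm f x := grad_eq_jm hx
    rw [fderiv_const_smul hx, det_one_add_smul_fderiv, hgj]
  -- interpolation
  set c : ℕ → ℝ := fun k => (Lagrange.basis (Finset.range (n + 1)) v k).coeff n with hc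
  have hinterp : ∀ P : Polynomial ℝ, P.natDegree ≤ n →
      P.coeff n = ∑ k ∈ Finset.range (n + 1), P.eval (v k) * c k := by
    intro P hP
    have hdeg : P.degree < (Finset.range (n + 1)).card := by
      rw [Finset.card_range]
      exact lt_of_le_of_lt (Polynomial.degree_le_of_natDegree_le hP) (by exact_mod_cast Nat.lt_succ_self n)
    have h1 := Lagrange.eq_interpolate hvinj hdeg
    conv_lhs => rw [h1]
    simp [Lagrange.interpolate_apply, hc]
  have hdet : ∀ A : Matrix (Fin n) (Fin n) ℝ,
      A.det = ∑ k ∈ Finset.range (n + 1), (1 + v k • A).det * c k := by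
    intro A
    have h1 := hinterp (Matrix.det ((Polynomial.X : Polynomial ℝ) • A.map Polynomial.C
      + (1 : Matrix (Fin n) (Fin n) ℝ).map Polynomial.C))
      (by simpa using Polynomial.natDegree_det_X_add_C_le A 1)
    have h2 := Polynomial.coeff_det_X_add_C_card A 1
    rw [Fintype.card_fin] at h2
    rw [← h2, h1]
    refine Finset.sum_congr rfl fun k _ => ?_
    congr 1
    rw [← Polynomial.coe_evalRingHom, RingHom.map_det]
    congr 1
    ext i j
    by_cases hij : i = j
    · simp [hij]
      ring
    · simp [hij]
      ring
  have hsum : ∑ k ∈ Finset.range (n + 1), c k = 0 := by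
    have := hinterp 1 (by simp)
    rw [Polynomial.coeff_one, if_neg hn.ne'] at this
    simpa using this.symm
  have hint : ∀ k ∈ Finset.range (n + 1), Integrable (fun x => (1 + v k • jm f x).det * c k)
      (volume.restrict (closedBall (0 : EuclideanSpace ℝ (Fin n)) R)) := by
    intro k hk
    apply Integrable.mul_const
    rcases eq_or_ne (volume.real (closedBall (0 : EuclideanSpace ℝ (Fin n)) R)) 0 with h | h
    · have : volume (closedBall (0 : EuclideanSpace ℝ (Fin n)) R) = 0 := by
        rcases (ENNReal.toReal_eq_zero_iff _).1 h with h | h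
        · exact h
        · exact absurd h measure_closedBall_lt_top.ne
      rw [Measure.restrict_eq_zero.2 this]
      exact integrable_zero_measure
    · by_contra hni
      have := hB k hk
      rw [integral_undef hni] at this
      exact h this.symm
  simp_rw [hdet (jm f _)]
  rw [integral_finsetSum _ hint]
  simp_rw [integral_mul_const]
  rw [Finset.sum_congr rfl fun k hk => by rw [hB k hk]]
  rw [← Finset.mul_sum, hsum, mul_zero]

lemma jm_update {n : ℕ} (f : Fin n → EuclideanSpace ℝ (Fin n) → ℝ) (i : Fin n)
    (a : EuclideanSpace ℝ (Fin n) → ℝ) (x : EuclideanSpace ℝ (Fin n)) :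
    jm (Function.update f i a) x =
      (jm f x).updateRow i (fun j => fderiv ℝ a x (EuclideanSpace.single j 1)) := by
  ext k j
  by_cases h : k = i
  · subst h; simp [jm]
  · simp [jm, h]

lemma det_jm_eq_zero {n : ℕ} (f : Fin n → EuclideanSpace ℝ (Fin n) → ℝ) (i : Fin n)
    {x : EuclideanSpace ℝ (Fin n)} (hx : x ∉ tsupport (f i)) : (jm f x).det = 0 := by
  apply Matrix.det_eq_zero_of_row_eq_zero i
  intro j
  have : fderiv ℝ (f i) x = 0 := by
    have h := (notMem_tsupport_iff_eventuallyEq.1 hx).fderiv_eq (𝕜 := ℝ)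
    rw [h]
    exact fderiv_const_apply 0
  simp [jm, this]

lemma integrable_det_jm {n : ℕ} {f : Fin n → EuclideanSpace ℝ (Fin n) → ℝ}
    {K : ℝ≥0} (hf : ∀ i, LipschitzWith K (f i)) (i : Fin n) (hi : HasCompactSupport (f i)) :
    Integrable (fun x => (jm f x).det) := by
  have h1 : IntegrableOn (fun x => (jm f x).det) (tsupport (f i)) :=
    IntegrableOn.of_bound hi.measure_lt_top (measurable_det_jm f).aestronglyMeasurable _
      (ae_of_all _ fun x => det_jm_le hf x)
  exact (integrableOn_iff_integrable_of_support_subset (fun x hx => by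
    by_contra h
    exact hx (det_jm_eq_zero f i h))).1 h1

/-- Null Lagrangian property when only one component has compact support. -/
lemma integral_det_jm_zero {n : ℕ} {f : Fin n → EuclideanSpace ℝ (Fin n) → ℝ}
    {K : ℝ≥0} (hf : ∀ i, LipschitzWith K (f i)) (i : Fin n) (hi : HasCompactSupport (f i)) :
    ∫ x, (jm f x).det = 0 := by
  obtain ⟨R, hR0, hR⟩ : ∃ R : ℝ, 0 ≤ R ∧
      tsupport (f i) ⊆ closedBall (0 : EuclideanSpace ℝ (Fin n)) R := by
    obtain ⟨R, hR⟩ := (IsCompact.isBounded hi).subset_closedBall 0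
    exact ⟨max R 0, le_max_right _ _, hR.trans (closedBall_subset_closedBall (le_max_left _ _))⟩
  set M : ℝ := ∑ j, |f j 0| + K * (R + 1) with hM
  have hM0 : 0 ≤ M := by positivity
  have hfM : ∀ j x, ‖x‖ ≤ R + 1 → |f j x| ≤ M := by
    intro j x hx
    have h1 := (hf j).dist_le_mul x 0
    rw [dist_zero_right, Real.dist_eq] at h1
    have h2 : |f j 0| ≤ ∑ j, |f j 0| :=
      Finset.single_le_sum (f := fun j => |f j 0|) (fun _ _ => abs_nonneg _) (Finset.mem_univ j)
    have h3 : (K:ℝ) * ‖x‖ ≤ K * (R + 1) := by gcongr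
    have h4 : |f j x| ≤ |f j x - f j 0| + |f j 0| := by
      have := abs_add_le (f j x - f j 0) (f j 0)
      simpa using this
    linarith
  set c : EuclideanSpace ℝ (Fin n) → ℝ := fun x => max (M + (R + 1) - ‖x‖) 0 with hc
  have hc0 : ∀ x, 0 ≤ c x := fun x => le_max_right _ _
  have hcl : LipschitzWith 1 c := by
    have h1 : LipschitzWith 1 (fun x : EuclideanSpace ℝ (Fin n) => M + (R + 1) - ‖x‖) := by
      have := (LipschitzWith.const (α := EuclideanSpace ℝ (Fin n)) (M + (R + 1))).sub
        (lipschitzWith_one_norm (E := EuclideanSpace ℝ (Fin n)))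
      simpa using this
    exact h1.max_const 0
  set h : Fin n → EuclideanSpace ℝ (Fin n) → ℝ := fun j x => max (-c x) (min (f j x) (c x)) with hh
  have hhl : ∀ j, LipschitzWith (max 1 (max K 1)) (h j) := fun j =>
    hcl.neg.max ((hf j).min hcl)
  have hhf : ∀ j x, ‖x‖ ≤ R + 1 → h j x = f j x := by
    intro j x hx
    have h1 := abs_le.1 (hfM j x hx)
    have h2 : M ≤ c x := le_max_of_le_left (by linarith)
    simp only [hh]
    rw [min_eq_left (by linarith), max_eq_right (by linarith)]
  have hhi : h i = f i := by
    ext x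
    rcases le_total ‖x‖ (R + 1) with hx | hx
    · exact hhf i x hx
    · have : f i x = 0 := by
        apply image_eq_zero_of_notMem_tsupport
        intro hx'
        have := hR hx'
        rw [mem_closedBall_zero_iff] at this
        linarith
      simp [hh, this, hc0 x]
  have hdet : ∀ x, (jm h x).det = (jm f x).det := by
    intro x
    rcases lt_or_ge ‖x‖ (R + 1) with hx | hx
    · congr 1
      ext j k
      have : h j =ᶠ[𝓝 x] f j := by
        filter_upwards [(isOpen_lt continuous_norm continuous_const).mem_nhds hx] with y hy
        exact hhf j y (le_of_lt hy)
      simp [jm, this.fderiv_eq]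
    · have hx' : x ∉ tsupport (f i) := fun hx' => by
        have := hR hx'
        rw [mem_closedBall_zero_iff] at this
        linarith
      rw [det_jm_eq_zero f i hx', det_jm_eq_zero h i (by rwa [hhi])]
  have key := integral_det_jm_zero_aux (lt_of_le_of_lt (Nat.zero_le _) i.2) hhl (R := M + (R + 1)) (by
    intro j x hx
    rw [mem_closedBall_zero_iff, not_le] at hx
    have : c x = 0 := max_eq_right (by linarith)
    simp [hh, this])
  simp_rw [hdet] at key
  rw [← key]
  symm
  apply setIntegral_eq_integral_of_forall_compl_eq_zero
  intro x hx
  apply det_jm_eq_zero f i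
  intro hx'
  exact hx (closedBall_subset_closedBall (by linarith) (hR hx'))

lemma lip_mul {E : Type*} [PseudoMetricSpace E] {φ f : E → ℝ} {K L : ℝ≥0}
    (hφ : LipschitzWith K φ) (hf : LipschitzWith L f) (hc : HasCompactSupport φ) :
    ∃ C, LipschitzWith C (fun x => φ x * f x) := by
  obtain ⟨M, hM⟩ := hc.exists_bound_of_continuousOn hφ.continuous.continuousOn
  obtain ⟨N, hN⟩ := hc.exists_bound_of_continuousOn hf.continuous.continuousOn
  have hM' : ∀ x, |φ x| ≤ max M 0 := by
    intro x
    by_cases hx : x ∈ tsupport φ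
    · exact le_max_of_le_left (hM x hx)
    · rw [image_eq_zero_of_notMem_tsupport hx]; simp
  have hN' : ∀ x, φ x ≠ 0 → |f x| ≤ max N 0 := by
    intro x hx
    exact le_max_of_le_left (hN x (subset_tsupport _ hx))
  have h1 : ∀ x y, φ x ≠ 0 →
      |φ x * f x - φ y * f y| ≤ (max N 0 * K + max M 0 * L) * dist x y := by
    intro x y hx
    have e : φ x * f x - φ y * f y = f x * (φ x - φ y) + φ y * (f x - f y) := by ring
    rw [e]
    refine (abs_add_le _ _).trans ?_
    rw [abs_mul, abs_mul, add_mul, mul_assoc, mul_assoc]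
    have a1 := hφ.dist_le_mul x y
    have a2 := hf.dist_le_mul x y
    rw [Real.dist_eq] at a1 a2
    gcongr
    · exact hN' x hx
    · exact hM' y
  refine ⟨(max N 0 * K + max M 0 * L).toNNReal, LipschitzWith.of_dist_le_mul fun x y => ?_⟩
  rw [Real.coe_toNNReal _ (by positivity), Real.dist_eq]
  by_cases hx : φ x = 0
  · by_cases hy : φ y = 0
    · simp only [hx, hy, zero_mul, sub_zero, abs_zero]
      positivity
    · rw [abs_sub_comm, dist_comm]; exact h1 y x hy
  · exact h1 x y hx

/-- Integration by parts. -/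
lemma integral_mul_det_jm {n : ℕ} {f : Fin n → EuclideanSpace ℝ (Fin n) → ℝ}
    {K : ℝ≥0} (hf : ∀ i, LipschitzWith K (f i)) (i : Fin n) {φ : EuclideanSpace ℝ (Fin n) → ℝ}
    (hφ : LipschitzWith K φ) (hc : HasCompactSupport φ) :
    ∫ x, φ x * (jm f x).det = - ∫ x, f i x * (jm (Function.update f i φ) x).det := by
  obtain ⟨C, hC⟩ := lip_mul hφ (hf i) hc
  set p : EuclideanSpace ℝ (Fin n) → ℝ := fun x => φ x * f i x with hp
  have hpc : HasCompactSupport p := hc.mul_right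
  have hF : ∀ j, LipschitzWith (max K C) (Function.update f i p j) := by
    intro j
    by_cases h : j = i
    · subst h; simpa using hC.weaken (le_max_right _ _)
    · simpa [h] using (hf j).weaken (le_max_left _ _)
  have hFc : HasCompactSupport (Function.update f i p i) := by simpa using hpc
  have h0 := integral_det_jm_zero hF i hFc
  have hint := integrable_det_jm hF i hFc
  have hint2 : Integrable (fun x => φ x * (jm f x).det) :=
    (hφ.continuous.integrable_of_hasCompactSupport hc).mul_bdd
      (c := (n.factorial : ℝ) * (K : ℝ) ^ n)
      (measurable_det_jm f).aestronglyMeasurable (ae_of_all _ fun x => det_jm_le hf x)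
  have hae : ∀ᵐ x, (jm (Function.update f i p) x).det - φ x * (jm f x).det =
      f i x * (jm (Function.update f i φ) x).det := by
    filter_upwards [hφ.ae_differentiableAt (μ := volume), (hf i).ae_differentiableAt (μ := volume)]
      with x h1 h2
    rw [jm_update, jm_update]
    have e : (fun j => fderiv ℝ p x (EuclideanSpace.single j 1)) =
        φ x • (jm f x i) + f i x • (fun j => fderiv ℝ φ x (EuclideanSpace.single j 1)) := by
      ext j
      rw [hp, fderiv_fun_mul h1 h2]
      simp [jm]
    rw [e, Matrix.det_updateRow_add, Matrix.det_updateRow_smul, Matrix.det_updateRow_smul,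
      Matrix.updateRow_eq_self]
    ring
  rw [← integral_congr_ae hae, integral_sub hint hint2, h0]
  ring

/-- Changing one component: quantitative estimate. -/
lemma est_one {n : ℕ} {f : Fin n → EuclideanSpace ℝ (Fin n) → ℝ}
    {K : ℝ≥0} (hf : ∀ i, LipschitzWith K (f i)) (i : Fin n) {φ a b : EuclideanSpace ℝ (Fin n) → ℝ}
    (hφ : LipschitzWith K φ) (hc : HasCompactSupport φ)
    (ha : LipschitzWith K a) (hb : LipschitzWith K b)
    {Ω : Set (EuclideanSpace ℝ (Fin n))} (hΩ : volume Ω < ∞) (hs : tsupport φ ⊆ Ω)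
    {ε : ℝ} (hε : ∀ x ∈ Ω, |a x - b x| ≤ ε) :
    |(∫ x, φ x * (jm (Function.update f i a) x).det) - ∫ x, φ x * (jm (Function.update f i b) x).det|
      ≤ ε * ((n.factorial : ℝ) * (K : ℝ) ^ n) * volume.real Ω := by
  have hu : ∀ {g}, LipschitzWith K g → ∀ j, LipschitzWith K (Function.update f i g j) := by
    intro g hg j
    by_cases h : j = i
    · subst h; simpa using hg
    · simpa [h] using hf j
  have hφc : HasCompactSupport (Function.update f i φ i) := by simpa using hc
  have hI : ∀ {g}, LipschitzWith K g →
      Integrable fun x => g x * (jm (Function.update f i φ) x).det := by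
    intro g hg
    have hk := integrable_det_jm (hu hφ) i hφc
    obtain ⟨N, hN⟩ := hc.exists_bound_of_continuousOn hg.continuous.continuousOn
    have h1 : IntegrableOn (fun x => g x * (jm (Function.update f i φ) x).det) (tsupport φ) :=
      (hk.integrableOn).bdd_mul (c := N) hg.continuous.measurable.aestronglyMeasurable
        ((ae_restrict_iff' (isClosed_tsupport φ).measurableSet).2 (ae_of_all _ hN))
    refine (integrableOn_iff_integrable_of_support_subset (fun x hx => ?_)).1 h1
    by_contra h
    apply hx
    have := det_jm_eq_zero (Function.update f i φ) i (x := x) (by simpa using h)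
    simp [this]
  have e : ∀ {g}, LipschitzWith K g → ∫ x, φ x * (jm (Function.update f i g) x).det =
      - ∫ x, g x * (jm (Function.update f i φ) x).det := by
    intro g hg
    have := integral_mul_det_jm (hu hg) i hφ hc
    simpa using this
  rw [e ha, e hb]
  have e2 : (- ∫ x, a x * (jm (Function.update f i φ) x).det)
      - (- ∫ x, b x * (jm (Function.update f i φ) x).det) =
      - ∫ x in Ω, (a x - b x) * (jm (Function.update f i φ) x).det := by
    rw [setIntegral_eq_integral_of_forall_compl_eq_zero]
    · simp_rw [sub_mul]
      rw [integral_sub (hI ha) (hI hb)]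
      ring
    · intro x hx
      have := det_jm_eq_zero (Function.update f i φ) i (x := x)
        (by simpa using fun h => hx (hs h))
      simp [this]
  rw [e2, abs_neg]
  have := norm_setIntegral_le_of_norm_le_const (μ := volume) (s := Ω)
    (f := fun x => (a x - b x) * (jm (Function.update f i φ) x).det)
    (C := ε * ((n.factorial : ℝ) * (K : ℝ) ^ n)) hΩ (fun x hx => by
      rw [norm_mul]
      have h1 := hε x hx
      have h2 := det_jm_le (hu hφ) x
      exact mul_le_mul h1 h2 (abs_nonneg _) ((abs_nonneg _).trans h1))
  exact this

lemma est_all {n : ℕ} {f h : Fin n → EuclideanSpace ℝ (Fin n) → ℝ}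
    {K : ℝ≥0} (hf : ∀ i, LipschitzWith K (f i)) (hh : ∀ i, LipschitzWith K (h i))
    {φ : EuclideanSpace ℝ (Fin n) → ℝ}
    (hφ : LipschitzWith K φ) (hc : HasCompactSupport φ)
    {Ω : Set (EuclideanSpace ℝ (Fin n))} (hΩ : volume Ω < ∞) (hs : tsupport φ ⊆ Ω)
    {ε : ℝ} (hε : ∀ i, ∀ x ∈ Ω, |f i x - h i x| ≤ ε) :
    |(∫ x, φ x * (jm f x).det) - ∫ x, φ x * (jm h x).det|
      ≤ n * (ε * ((n.factorial : ℝ) * (K : ℝ) ^ n) * volume.real Ω) := by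
  classical
  have key : ∀ s : Finset (Fin n),
      |(∫ x, φ x * (jm (fun i => if i ∈ s then f i else h i) x).det) - ∫ x, φ x * (jm h x).det|
      ≤ s.card * (ε * ((n.factorial : ℝ) * (K : ℝ) ^ n) * volume.real Ω) := by
    intro s
    induction s using Finset.induction_on with
    | empty => simp
    | insert i s hi ih =>
      have hm : ∀ j, LipschitzWith K ((fun i => if i ∈ s then f i else h i) j) := by
        intro j
        by_cases hj : j ∈ s
        · simpa [hj] using hf j
        · simpa [hj] using hh j
      have h1 := est_one hm i hφ hc (hf i) (hh i) hΩ hs (hε i)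
      have e1 : Function.update (fun i => if i ∈ s then f i else h i) i (f i) =
          fun j => if j ∈ insert i s then f j else h j := by
        ext j x
        by_cases hj : j = i
        · subst hj; simp
        · simp [hj]
      have e2 : Function.update (fun i => if i ∈ s then f i else h i) i (h i) =
          fun i => if i ∈ s then f i else h i := by
        ext j x
        by_cases hj : j = i
        · subst hj; simp [hi]
        · simp [hj]
      rw [e1, e2] at h1
      rw [Finset.card_insert_of_notMem hi]
      push_cast
      rw [add_mul, one_mul, add_comm]
      exact (abs_sub_le _ _ _).trans (add_le_add h1 ih)
  simpa using key Finset.univ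

/-- Lipschitz functions with compact support in `Ω` are dense in `L¹(Ω)`. -/
lemma dense_lip {n : ℕ} {Ω : Set (EuclideanSpace ℝ (Fin n))} (hΩo : IsOpen Ω)
    {g : EuclideanSpace ℝ (Fin n) → ℝ} (hg : IntegrableOn g Ω) {ε : ℝ≥0∞} (hε : ε ≠ 0) :
    ∃ φ : EuclideanSpace ℝ (Fin n) → ℝ, eLpNorm (g - φ) 1 (volume.restrict Ω) ≤ ε ∧
      ((∃ K, LipschitzWith K φ) ∧ HasCompactSupport φ ∧ tsupport φ ⊆ Ω) := by
  refine MemLp.induction_dense ENNReal.one_ne_top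
    (fun φ => (∃ K, LipschitzWith K φ) ∧ HasCompactSupport φ ∧ tsupport φ ⊆ Ω) ?_ ?_ ?_
    (memLp_one_iff_integrable.2 hg) hε
  · intro c s hs hμs ε hε
    obtain ⟨η, hη0, hη⟩ : ∃ η : ℝ≥0∞, η ≠ 0 ∧ ‖c‖ₑ * (η + η) ≤ ε := by
      have ht : Tendsto (fun x : ℝ≥0∞ => ‖c‖ₑ * (x + x)) (𝓝[>] 0) (𝓝 0) := by
        have : Tendsto (fun x : ℝ≥0∞ => ‖c‖ₑ * (x + x)) (𝓝 0) (𝓝 (‖c‖ₑ * (0 + 0))) :=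
          ENNReal.Tendsto.const_mul (tendsto_id.add tendsto_id) (Or.inr enorm_ne_top)
        simp only [add_zero, mul_zero] at this
        exact this.mono_left nhdsWithin_le_nhds
      have h1 := ht.eventually (ge_mem_nhds (pos_iff_ne_zero.2 hε))
      obtain ⟨η, h2, h3⟩ := (h1.and self_mem_nhdsWithin).exists
      exact ⟨η, (ne_of_gt h3), h2⟩
    have hA : MeasurableSet (s ∩ Ω) := hs.inter hΩo.measurableSet
    have hAf : volume (s ∩ Ω) ≠ ∞ := by
      rw [← Measure.restrict_apply hs]; exact hμs.ne
    obtain ⟨K, hKA, hK, hKη⟩ := hA.exists_isCompact_sdiff_lt hAf hη0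
    obtain ⟨U, hKU, hU, hUη⟩ := K.exists_isOpen_lt_add (μ := volume) hK.measure_lt_top.ne hη0
    have hUK : volume (U \ K) < η :=
      measure_sdiff_lt_of_lt_add hK.measurableSet.nullMeasurableSet hKU hK.measure_lt_top.ne hUη
    obtain ⟨δ, hδ, hδU⟩ := hK.exists_cthickening_subset_open (hU.inter hΩo)
      (Set.subset_inter hKU (hKA.trans Set.inter_subset_right))
    set θ : EuclideanSpace ℝ (Fin n) → ℝ := fun x => c * (thickenedIndicator hδ K x : ℝ) with hθ
    have hsupp : tsupport θ ⊆ cthickening δ K := by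
      refine closure_minimal (fun x hx => ?_) isClosed_cthickening
      by_contra h
      apply hx
      have : x ∉ thickening δ K := fun h' => h (thickening_subset_cthickening _ _ h')
      simp only [hθ, thickenedIndicator_zero hδ K this, NNReal.coe_zero, mul_zero]
    refine ⟨θ, ?_, ⟨‖c‖₊ * δ.toNNReal⁻¹, ?_⟩, ?_, ?_⟩
    · rw [eLpNorm_one_eq_lintegral_enorm]
      calc ∫⁻ x in Ω, ‖(θ - s.indicator fun _ => c) x‖ₑ
          ≤ ∫⁻ x in Ω, ((U \ K) ∪ ((s ∩ Ω) \ K)).indicator (fun _ => ‖c‖ₑ) x := by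
            apply setLIntegral_mono' hΩo.measurableSet
            intro x hx
            by_cases hxK : x ∈ K
            · have h1 : x ∈ s := (hKA hxK).1
              have h2 : θ x = c := by
                simp only [hθ, thickenedIndicator_one hδ K hxK, NNReal.coe_one, mul_one]
              simp [h2, h1]
            · by_cases hxU : x ∈ U ∨ x ∈ s
              · rw [Set.indicator_of_mem (by
                  rcases hxU with h | h
                  · exact Or.inl ⟨h, hxK⟩
                  · exact Or.inr ⟨⟨h, hx⟩, hxK⟩)]
                rw [enorm_le_iff_norm_le]
                have h1 := thickenedIndicator_le_one hδ K x
                have h1' : (thickenedIndicator hδ K x : ℝ) ≤ 1 := by exact_mod_cast h1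
                have h0 : (0:ℝ) ≤ thickenedIndicator hδ K x := NNReal.coe_nonneg _
                by_cases hxs : x ∈ s
                · have : (θ - s.indicator fun _ => c) x =
                      c * ((thickenedIndicator hδ K x : ℝ) - 1) := by
                    simp [hθ, hxs]; ring
                  rw [this, norm_mul]
                  refine mul_le_of_le_one_right (norm_nonneg _) ?_
                  rw [Real.norm_eq_abs, abs_le]; constructor <;> linarith
                · have : (θ - s.indicator fun _ => c) x =
                      c * (thickenedIndicator hδ K x : ℝ) := by
                    simp [hθ, hxs]
                  rw [this, norm_mul]
                  refine mul_le_of_le_one_right (norm_nonneg _) ?_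
                  rw [Real.norm_eq_abs, abs_le]; constructor <;> linarith
              · push Not at hxU
                have h1 : θ x = 0 := by
                  apply image_eq_zero_of_notMem_tsupport
                  exact fun h => hxU.1 (hδU (hsupp h)).1
                simp [h1, hxU.2]
        _ ≤ ∫⁻ x, ((U \ K) ∪ ((s ∩ Ω) \ K)).indicator (fun _ => ‖c‖ₑ) x :=
            lintegral_mono' Measure.restrict_le_self le_rfl
        _ ≤ ‖c‖ₑ * volume ((U \ K) ∪ ((s ∩ Ω) \ K)) := lintegral_indicator_const_le _ _
        _ ≤ ‖c‖ₑ * (η + η) := by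
            gcongr
            exact (measure_union_le _ _).trans (add_le_add hUK.le hKη.le)
        _ ≤ ε := hη
    · apply LipschitzWith.of_dist_le_mul
      intro x y
      have := (lipschitzWith_thickenedIndicator hδ K).dist_le_mul x y
      rw [NNReal.dist_eq] at this
      rw [Real.dist_eq, ← mul_sub, abs_mul, NNReal.coe_mul, mul_assoc]
      exact mul_le_mul_of_nonneg_left this (abs_nonneg _)
    · exact hK.cthickening.of_isClosed_subset (isClosed_tsupport _) hsupp
    · exact hsupp.trans (hδU.trans Set.inter_subset_right)
  · rintro f g ⟨⟨K, hK⟩, hf, hfs⟩ ⟨⟨L, hL⟩, hg, hgs⟩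
    exact ⟨⟨_, hK.add hL⟩, hf.add hg, (tsupport_add f g).trans (Set.union_subset hfs hgs)⟩
  · rintro f ⟨⟨K, hK⟩, -, -⟩
    exact hK.continuous.aestronglyMeasurable

/-- Weak* continuity of the determinant: if `u_k : Ω → ℝⁿ` are Lipschitz with a common
Lipschitz constant `ℓ` and converge uniformly on the bounded open set `Ω` to `u`, then
for every `g ∈ L¹(Ω)`, `∫_Ω g det ∇u_k → ∫_Ω g det ∇u`. -/
theorem stmt7 {n : ℕ} (Ω : Set (EuclideanSpace ℝ (Fin n)))
    (hΩo : IsOpen Ω) (hΩb : Bornology.IsBounded Ω)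
    (ℓ : ℝ≥0) (u : ℕ → EuclideanSpace ℝ (Fin n) → EuclideanSpace ℝ (Fin n))
    (ulim : EuclideanSpace ℝ (Fin n) → EuclideanSpace ℝ (Fin n))
    (hLip : ∀ k, LipschitzWith ℓ (u k))
    (hconv : TendstoUniformlyOn u ulim atTop Ω)
    (g : EuclideanSpace ℝ (Fin n) → ℝ) (hg : IntegrableOn g Ω) :
    Tendsto (fun k => ∫ x in Ω, g x * (grad (u k) x).det) atTop
      (nhds (∫ x in Ω, g x * (grad ulim x).det)) := by
  have hcoord : ∀ (i : Fin n) (a b : EuclideanSpace ℝ (Fin n)), |a i - b i| ≤ dist a b := by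
    intro i a b
    rw [dist_eq_norm]
    exact PiLp.norm_apply_le (a - b) i
  have hvol : volume Ω < ∞ := hΩb.measure_lt_top
  have hlimL : ∀ x ∈ Ω, ∀ y ∈ Ω, dist (ulim x) (ulim y) ≤ ℓ * dist x y := by
    intro x hx y hy
    exact le_of_tendsto ((hconv.tendsto_at hx).dist (hconv.tendsto_at hy))
      (Eventually.of_forall fun k => (hLip k).dist_le_mul x y)
  have hext : ∀ i, ∃ h : EuclideanSpace ℝ (Fin n) → ℝ, LipschitzWith ℓ h ∧
      Set.EqOn (fun x => ulim x i) h Ω := by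
    intro i
    apply LipschitzOnWith.extend_real
    apply LipschitzOnWith.of_dist_le_mul
    intro x hx y hy
    exact (hcoord i _ _).trans (hlimL x hx y hy)
  choose h hhL hhE using hext
  have hfL : ∀ k i, LipschitzWith ℓ (fun x => u k x i) := by
    intro k i
    apply LipschitzWith.of_dist_le_mul
    intro x y
    exact (hcoord i _ _).trans ((hLip k).dist_le_mul x y)
  have e1 : ∀ k, ∫ x in Ω, g x * (grad (u k) x).det =
      ∫ x in Ω, g x * (jm (fun i y => u k y i) x).det := by
    intro k
    apply integral_congr_ae
    apply ae_restrict_of_ae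
    filter_upwards [(hLip k).ae_differentiableAt (μ := volume)] with x hx
    rw [grad_eq_jm hx]
  have e2 : ∫ x in Ω, g x * (grad ulim x).det = ∫ x in Ω, g x * (jm h x).det := by
    apply integral_congr_ae
    have hl : LipschitzOnWith ℓ ulim Ω := LipschitzOnWith.of_dist_le_mul hlimL
    rw [Filter.EventuallyEq, ae_restrict_iff' hΩo.measurableSet]
    filter_upwards [hl.ae_differentiableWithinAt_of_mem (μ := volume)] with x hx hxΩ
    rw [grad_eq_jm ((hx hxΩ).differentiableAt (hΩo.mem_nhds hxΩ))]
    congr 2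
    ext i j
    have : (fun y => ulim y i) =ᶠ[𝓝 x] h i := by
      filter_upwards [hΩo.mem_nhds hxΩ] with y hy
      exact hhE i hy
    simp [jm, this.fderiv_eq]
  rw [e2]
  simp_rw [e1]
  set C : ℝ := (n.factorial : ℝ) * (ℓ : ℝ) ^ n with hC
  have hC0 : 0 ≤ C := by positivity
  rw [Metric.tendsto_atTop]
  intro ε hε
  set η : ℝ := ε / (4 * (C + 1)) with hη
  have hη0 : 0 < η := by positivity
  obtain ⟨φ, hφη, ⟨K, hK⟩, hφc, hφs⟩ := dense_lip hΩo hg (ENNReal.ofReal_pos.2 hη0).ne'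
  have hφi : IntegrableOn φ Ω := (hK.continuous.integrable_of_hasCompactSupport hφc).integrableOn
  have hsm : ∀ f : Fin n → EuclideanSpace ℝ (Fin n) → ℝ, (∀ i, LipschitzWith ℓ (f i)) →
      |(∫ x in Ω, g x * (jm f x).det) - ∫ x, φ x * (jm f x).det| ≤ C * η := by
    intro f hf
    have hm : ∀ {p : EuclideanSpace ℝ (Fin n) → ℝ}, IntegrableOn p Ω →
        IntegrableOn (fun x => p x * (jm f x).det) Ω := fun hp =>
      Integrable.mul_bdd (c := C) hp (measurable_det_jm f).aestronglyMeasurable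
        (ae_of_all _ fun x => det_jm_le hf x)
    have r : ∫ x, φ x * (jm f x).det = ∫ x in Ω, φ x * (jm f x).det := by
      symm
      apply setIntegral_eq_integral_of_forall_compl_eq_zero
      intro x hx
      rw [image_eq_zero_of_notMem_tsupport (fun h => hx (hφs h)), zero_mul]
    rw [r, ← integral_sub (hm hg) (hm hφi)]
    have hd : IntegrableOn (g - φ) Ω := Integrable.sub hg hφi
    calc |∫ x in Ω, (g x * (jm f x).det - φ x * (jm f x).det)|
        ≤ ∫ x in Ω, C * ‖(g - φ) x‖ := by
          rw [← Real.norm_eq_abs]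
          apply norm_integral_le_of_norm_le (hd.norm.const_mul C)
          refine ae_of_all _ fun x => ?_
          rw [← sub_mul, norm_mul, mul_comm]
          exact mul_le_mul_of_nonneg_right (det_jm_le hf x) (norm_nonneg _)
      _ = C * ∫ x in Ω, ‖(g - φ) x‖ := integral_const_mul _ _
      _ ≤ C * η := by
          gcongr
          rw [integral_norm_eq_lintegral_enorm hd.aestronglyMeasurable,
            ← eLpNorm_one_eq_lintegral_enorm]
          exact ENNReal.toReal_le_of_le_ofReal hη0.le hφη
  set L : ℝ≥0 := max ℓ K with hLdef
  set D : ℝ := n * ((n.factorial : ℝ) * (L : ℝ) ^ n * volume.real Ω) with hD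
  have hD0 : 0 ≤ D := by positivity
  set τ : ℝ := ε / (4 * (D + 1)) with hτ
  have hτ0 : 0 < τ := by positivity
  obtain ⟨N, hN⟩ := eventually_atTop.1 (Metric.tendstoUniformlyOn_iff.1 hconv τ hτ0)
  refine ⟨N, fun k hk => ?_⟩
  have key := est_all (f := fun i y => u k y i) (h := h)
    (fun i => (hfL k i).weaken (le_max_left ℓ K)) (fun i => (hhL i).weaken (le_max_left ℓ K))
    (hK.weaken (le_max_right ℓ K)) hφc hvol hφs (ε := τ) (by
      intro i x hx
      have h1 := hN k hk x hx
      have h2 := hhE i hx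
      rw [← h2, abs_sub_comm]
      exact (hcoord i _ _).trans h1.le)
  have a1 := hsm _ (hfL k)
  have a2 := hsm h hhL
  have b1 : C * η ≤ ε / 4 := by
    rw [hη, mul_div_assoc', div_le_div_iff₀ (by positivity) (by norm_num)]
    nlinarith
  have b2 : n * (τ * ((n.factorial : ℝ) * (L : ℝ) ^ n) * volume.real Ω) ≤ ε / 4 := by
    have : n * (τ * ((n.factorial : ℝ) * (L : ℝ) ^ n) * volume.real Ω) = D * τ := by
      rw [hD]; ring
    rw [this, hτ, mul_div_assoc', div_le_div_iff₀ (by positivity) (by norm_num)]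
    nlinarith
  rw [Real.dist_eq]
  rw [abs_le] at a1 a2 key
  rw [abs_lt]
  constructor <;> linarith [a1.1, a1.2, a2.1, a2.2, key.1, key.2]
end
end

section
/- (Eisen; Ball–Currie–Olver) Let Ω ⊂ ℝⁿ be a bounded measurable set and let Φ : Ω × ℝ^s × ℝ^σ → ℝ ∪ {+∞} satisfy: (i) Φ(·,z,a) is Lebesgue measurable for all (z,a) ∈ ℝ^s × ℝ^σ; (ii) Φ(x,·,·) is continuous (with respect to the topology of ℝ ∪ {+∞}) for almost every x ∈ Ω; (iii) Φ(x,z,·) : ℝ^σ → ℝ ∪ {+∞} is convex for a.e. x and all z. Assume moreover there exists φ ∈ L¹(Ω) with Φ(x,z,a) ≥ φ(x) for a.e. x and all (z,a). Let {z_k} ⊂ L¹(Ω;ℝ^s) converge to z almost everywhere in Ω and let {a_k} ⊂ L¹(Ω;ℝ^σ) converge weakly in L¹(Ω;ℝ^σ) to a (i.e., ∫_Ω ⟨g, a_k⟩ dx → ∫_Ω ⟨g, a⟩ dx for every g ∈ L^∞(Ω;ℝ^σ)). Then ∫_Ω Φ(x, z(x), a(x)) dx ≤ liminf_{k→∞}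 ∫_Ω Φ(x, z_k(x), a_k(x)) dx. -/
open MeasureTheory Filter Topology Metric Bornology
open scoped ENNReal NNReal

noncomputable section

/-- The nonnegative part of an extended real, as an element of `ℝ≥0∞`. -/
def erealToENNReal (e : EReal) : ℝ≥0∞ := if e = ⊤ then ⊤ else ENNReal.ofReal e.toReal

/-- The integral of an `EReal`-valued function: the difference (in `EReal`) of the lower
integrals of its positive and negative parts. -/
def eintegral {α : Type*} [MeasurableSpace α] (μ : Measure α) (F : α → EReal) : EReal :=
  ((∫⁻ x, erealToENNReal (F x) ∂μ : ℝ≥0∞) : EReal) -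
    ((∫⁻ x, erealToENNReal (-(F x)) ∂μ : ℝ≥0∞) : EReal)

lemma eintegral_mono {α : Type*} [MeasurableSpace α] (μ : Measure α) {F G : α → EReal}
    (h : ∀ x, F x ≤ G x) : eintegral μ F ≤ eintegral μ G := by
  unfold eintegral
  apply EReal.sub_le_sub
  · exact EReal.coe_ennreal_le_coe_ennreal_iff.2
      (lintegral_mono fun x => EReal.toENNReal_le_toENNReal (h x))
  · exact EReal.coe_ennreal_le_coe_ennreal_iff.2
      (lintegral_mono fun x => EReal.toENNReal_le_toENNReal (EReal.neg_le_neg_iff.2 (h x)))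

lemma eintegral_coe {α : Type*} [MeasurableSpace α] (μ : Measure α) {u : α → ℝ}
    (hu : Integrable u μ) : eintegral μ (fun x => (u x : EReal)) = ((∫ x, u x ∂μ : ℝ) : EReal) := by
  unfold eintegral
  rw [integral_eq_lintegral_pos_part_sub_lintegral_neg_part hu]
  have h1 : (∫⁻ x, ENNReal.ofReal (u x) ∂μ) ≠ ⊤ := by
    have := hu.lintegral_lt_top
    exact this.ne
  have h2 : (∫⁻ x, ENNReal.ofReal (-u x) ∂μ) ≠ ⊤ := by
    have := hu.neg.lintegral_lt_top
    exact this.ne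
  rw [EReal.coe_sub, EReal.coe_ennreal_toReal h1, EReal.coe_ennreal_toReal h2]
  rfl

lemma eintegral_le_of_monotone {α : Type*} [MeasurableSpace α] (μ : Measure α) {u : ℕ → α → ℝ}
    (hum : ∀ n, Measurable (u n))
    (hu : ∀ n, Integrable (u n) μ) (hmono : ∀ x, Monotone fun n => u n x) {F : α → EReal}
    (hF : ∀ x, F x ≤ ⨆ n, (u n x : EReal)) {C : ℝ} (hC : ∀ n, ∫ x, u n x ∂μ ≤ C) :
    eintegral μ F ≤ C := by
  refine (eintegral_mono μ hF).trans ?_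
  have ht : ∀ x, Tendsto (fun n => (u n x : EReal)) atTop (𝓝 (⨆ n, (u n x : EReal))) := fun x =>
    tendsto_atTop_iSup fun i j hij => EReal.coe_le_coe_iff.2 (hmono x hij)
  have h1 : Tendsto (fun n => ∫⁻ x, erealToENNReal (u n x : EReal) ∂μ) atTop
      (𝓝 (∫⁻ x, erealToENNReal (⨆ n, (u n x : EReal)) ∂μ)) := by
    apply lintegral_tendsto_of_tendsto_of_monotone
    · intro n
      exact ((hum n).coe_real_ereal.ereal_toENNReal).aemeasurable
    · refine ae_of_all _ fun x i j hij => ?_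
      exact EReal.toENNReal_le_toENNReal (EReal.coe_le_coe_iff.2 (hmono x hij))
    · refine ae_of_all _ fun x => ?_
      exact (EReal.continuous_toENNReal.tendsto _).comp (ht x)
  have h2 : Tendsto (fun n => ∫⁻ x, erealToENNReal (-(u n x : EReal)) ∂μ) atTop
      (𝓝 (∫⁻ x, erealToENNReal (-⨆ n, (u n x : EReal)) ∂μ)) := by
    apply lintegral_tendsto_of_tendsto_of_antitone
    · intro n
      exact ((hum n).coe_real_ereal.neg.ereal_toENNReal).aemeasurable
    · refine ae_of_all _ fun x i j hij => ?_
      exact EReal.toENNReal_le_toENNReal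
        (EReal.neg_le_neg_iff.2 (EReal.coe_le_coe_iff.2 (hmono x hij)))
    · exact (hu 0).neg.lintegral_lt_top.ne
    · refine ae_of_all _ fun x => ?_
      exact (EReal.continuous_toENNReal.tendsto _).comp ((continuous_neg.tendsto _).comp (ht x))
  have hfin : (∫⁻ x, erealToENNReal (-⨆ n, (u n x : EReal)) ∂μ) ≠ ⊤ := by
    refine ne_top_of_le_ne_top (hu 0).neg.lintegral_lt_top.ne (lintegral_mono fun x => ?_)
    exact EReal.toENNReal_le_toENNReal (y := ((- u 0 x : ℝ) : EReal)) (by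
      rw [EReal.coe_neg]
      exact EReal.neg_le_neg_iff.2 (le_iSup (fun n => (u n x : EReal)) 0))
  have h3 : Tendsto (fun n => eintegral μ (fun x => (u n x : EReal))) atTop
      (𝓝 (eintegral μ (fun x => ⨆ n, (u n x : EReal)))) := by
    unfold eintegral
    simp only [sub_eq_add_neg]
    have h1' := EReal.tendsto_coe_ennreal.2 h1
    have h2' := (continuous_neg.tendsto _).comp (EReal.tendsto_coe_ennreal.2 h2)
    refine (EReal.continuousAt_add (p := (_, _)) ?_ ?_).tendsto.comp (h1'.prodMk_nhds h2')
    · right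
      simpa using hfin
    · left
      simp
  refine le_of_tendsto' h3 fun n => ?_
  rw [eintegral_coe μ (hu n)]
  exact EReal.coe_le_coe_iff.2 (hC n)

lemma affine_minorant {σ : ℕ} (f : (Fin σ → ℝ) → EReal) (hf : Continuous f)
    (hconv : ∀ (a₁ a₂ : Fin σ → ℝ), ∀ t ∈ Set.Icc (0:ℝ) 1,
        f (t • a₁ + (1 - t) • a₂) ≤ (t : EReal) * f a₁ + ((1 - t : ℝ) : EReal) * f a₂)
    (φ : ℝ) (hφ : ∀ b, (φ : EReal) ≤ f b) (a : Fin σ → ℝ) (r : ℝ) (hr : (r : EReal) < f a) :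
    ∃ (p : Fin σ → ℝ) (c : ℝ), (∀ b, ((∑ i, p i * b i + c : ℝ) : EReal) ≤ f b) ∧
      r < ∑ i, p i * a i + c := by
  set T : Set ((Fin σ → ℝ) × ℝ) := {q | f q.1 ≤ (q.2 : EReal)} with hT
  have hcl : IsClosed T :=
    isClosed_le (hf.comp continuous_fst) (continuous_coe_real_ereal.comp continuous_snd)
  have hcv : Convex ℝ T := by
    intro x hx y hy s t hs ht hst
    have ht' : t = 1 - s := by linarith
    subst ht'
    have h1 := hconv x.1 y.1 s ⟨hs, by linarith⟩
    refine h1.trans ?_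
    have : ((s • x + (1 - s) • y).2 : EReal) = (s : EReal) * (x.2 : EReal) +
      ((1 - s : ℝ) : EReal) * (y.2 : EReal) := by
      simp only [Prod.snd_add, Prod.smul_snd, smul_eq_mul, EReal.coe_add, EReal.coe_mul]
    rw [this]
    exact add_le_add (mul_le_mul_of_nonneg_left hx (EReal.coe_nonneg.2 hs))
      (mul_le_mul_of_nonneg_left hy (EReal.coe_nonneg.2 ht))
  have hnot : (a, r) ∉ T := fun h => absurd h (not_le.2 hr)
  obtain ⟨F, u, hu, hF⟩ := geometric_hahn_banach_point_closed hcv hcl hnot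
  set α := F (0, 1) with hα
  have hdec : ∀ (b : Fin σ → ℝ) (t : ℝ), F (b, t) =
      ∑ i, F (Pi.single i 1, 0) * b i + α * t := by
    intro b t
    have e1 : ((b, t) : (Fin σ → ℝ) × ℝ) = (b, 0) + t • ((0 : Fin σ → ℝ), (1:ℝ)) := by
      ext <;> simp
    rw [e1, map_add, map_smul, ← hα]
    have := LinearMap.pi_apply_eq_sum_univ
      (F.toLinearMap.comp (LinearMap.inl ℝ (Fin σ → ℝ) ℝ)) b
    simp only [LinearMap.comp_apply, LinearMap.inl_apply, ContinuousLinearMap.coe_coe,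
      smul_eq_mul] at this
    rw [this, smul_eq_mul, mul_comm t]
    congr 1
    refine Finset.sum_congr rfl fun i _ => ?_
    rw [mul_comm]
    congr 3
    ext j
    simp [Pi.single_apply, eq_comm]
  set q : Fin σ → ℝ := fun i => F (Pi.single i 1, 0) with hq
  rw [hdec] at hu
  rcases lt_or_ge α 0 with hneg | hpos
  · -- the domain is empty
    have htop : ∀ b, f b = ⊤ := by
      intro b
      by_contra hb
      have hb' : f b ≠ ⊥ := fun h => by
        have := hφ b
        rw [h] at this
        simp at this
      lift f b to ℝ using ⟨hb, hb'⟩ with y hy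
      set t := max y ((u - ∑ i, q i * b i) / α)
      have h1 : (b, t) ∈ T := by
        change f b ≤ (t : EReal)
        rw [← hy]
        exact EReal.coe_le_coe_iff.2 (le_max_left _ _)
      have h2 := hF _ h1
      rw [hdec] at h2
      have h3 : (u - ∑ i, q i * b i) / α ≤ t := le_max_right _ _
      rw [div_le_iff_of_neg hneg] at h3
      simp only [hq] at h3
      linarith
    refine ⟨0, r + 1, fun b => by rw [htop]; exact le_top, by simp⟩
  · set d := u - (∑ i, q i * a i + α * r) with hd
    have hdpos : 0 < d := by simp only [hd, hq]; linarith
    set η := d / (|r - φ| + 1) with hη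
    have hb0 : 0 < |r - φ| + 1 := by positivity
    have hη0 : 0 < η := div_pos hdpos hb0
    have hηd : η * (r - φ) < d := by
      have : η * (|r - φ| + 1) = d := by rw [hη]; field_simp
      nlinarith [le_abs_self (r - φ)]
    have hβ : 0 < α + η := by linarith
    have hexp : ∀ b : Fin σ → ℝ, ∑ i, (-(q i) / (α + η)) * b i + (u + η * φ) / (α + η) =
        (u + η * φ - ∑ i, q i * b i) / (α + η) := by
      intro b
      rw [sub_div, Finset.sum_div, sub_eq_add_neg, ← Finset.sum_neg_distrib, add_comm]
      congr 1
      refine Finset.sum_congr rfl fun i _ => ?_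
      ring
    refine ⟨fun i => -(q i) / (α + η), (u + η * φ) / (α + η), ?_, ?_⟩
    · intro b
      rw [hexp]
      by_cases hb : f b = ⊤
      · rw [hb]; exact le_top
      have hb' : f b ≠ ⊥ := fun h => by
        have := hφ b
        rw [h] at this
        simp at this
      have hφb := hφ b
      have hFb : ∀ y : ℝ, f b ≤ y → u < F (b, y) := fun y hy => hF (b, y) hy
      lift f b to ℝ using ⟨hb, hb'⟩ with y hy
      have h2 := hFb y le_rfl
      rw [hdec] at h2
      rw [EReal.coe_le_coe_iff] at hφb ⊢
      rw [div_le_iff₀ hβ]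
      have : η * φ ≤ η * y := mul_le_mul_of_nonneg_left hφb hη0.le
      simp only [hq]
      nlinarith
    · rw [hexp, lt_div_iff₀ hβ]
      nlinarith

lemma l1_bound {X : Type*} [MeasurableSpace X] (μ : Measure X) [IsFiniteMeasure μ]
    (f : ℕ → X → ℝ) (hf : ∀ k, Integrable (f k) μ)
    (hw : ∀ g : X → ℝ, AEStronglyMeasurable g μ → (∃ C : ℝ, ∀ᵐ x ∂μ, ‖g x‖ ≤ C) →
      ∃ l, Tendsto (fun k => ∫ x, g x * f k x ∂μ) atTop (𝓝 l)) :
    ∃ C : ℝ, ∀ k, ∫ x, |f k x| ∂μ ≤ C := by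
  have hml : ∀ k, MemLp (f k) 1 μ := fun k => memLp_one_iff_integrable.2 (hf k)
  set B := ContinuousLinearMap.lpPairing (p := ⊤) (q := 1) μ (ContinuousLinearMap.mul ℝ ℝ)
  set g : ℕ → Lp ℝ ⊤ μ →L[ℝ] ℝ := fun k => B.flip ((hml k).toLp) with hg
  have hgap : ∀ k h, g k h = ∫ x, h x * f k x ∂μ := by
    intro k h
    simp only [hg, ContinuousLinearMap.flip_apply, B]
    rw [ContinuousLinearMap.lpPairing_eq_integral]
    apply integral_congr_ae
    filter_upwards [(hml k).coeFn_toLp] with x hx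
    simp [hx]
  obtain ⟨C, hC⟩ := banach_steinhaus (g := g) (by
    intro h
    obtain ⟨l, hl⟩ := hw h (Lp.aestronglyMeasurable h) ⟨‖h‖, by
      filter_upwards [enorm_ae_le_eLpNormEssSup h μ] with x hx
      rw [Lp.norm_def, eLpNorm_exponent_top]
      have h3 : eLpNormEssSup h μ ≠ ⊤ := by
        rw [← eLpNorm_exponent_top]; exact Lp.eLpNorm_ne_top h
      have := ENNReal.toReal_mono h3 hx
      simpa using this⟩
    obtain ⟨C, hC⟩ := hl.norm.bddAbove_range
    refine ⟨C, fun k => ?_⟩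
    rw [hgap]
    exact hC ⟨k, rfl⟩)
  refine ⟨C, fun k => ?_⟩
  set s : X → ℝ := fun x => SignType.sign (f k x) with hs
  have hsm : AEStronglyMeasurable s μ := by
    have : Measurable (fun y : ℝ => ((SignType.sign y : SignType) : ℝ)) := by
      have : (fun y : ℝ => ((SignType.sign y : SignType) : ℝ)) =
        fun y => if 0 < y then 1 else if y < 0 then -1 else 0 := by
        funext y
        rw [sign_apply]
        split_ifs <;> simp
      rw [this]
      exact Measurable.ite measurableSet_Ioi measurable_const
        (Measurable.ite measurableSet_Iio measurable_const measurable_const)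
    exact (this.comp_aemeasurable (hf k).aemeasurable).aestronglyMeasurable
  have hsb : ∀ x, ‖s x‖ ≤ 1 := by
    intro x
    simp only [hs]
    rcases lt_trichotomy (f k x) 0 with h | h | h
    · simp [sign_neg h]
    · simp [h]
    · simp [sign_pos h]
  have hsl : MemLp s ⊤ μ := memLp_top_of_bound hsm 1 (ae_of_all _ hsb)
  have h1 : ‖hsl.toLp‖ ≤ 1 := by
    rw [Lp.norm_toLp]
    apply ENNReal.toReal_le_of_le_ofReal zero_le_one
    rw [eLpNorm_exponent_top]
    exact eLpNormEssSup_le_of_ae_bound (ae_of_all _ hsb)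
  have h2 : g k hsl.toLp = ∫ x, |f k x| ∂μ := by
    rw [hgap]
    apply integral_congr_ae
    filter_upwards [hsl.coeFn_toLp] with x hx
    rw [hx]
    exact sign_mul_self _
  rw [← h2]
  calc g k hsl.toLp ≤ ‖g k hsl.toLp‖ := le_abs_self _
    _ ≤ ‖g k‖ * ‖hsl.toLp‖ := (g k).le_opNorm _
    _ ≤ ‖g k‖ * 1 := by gcongr
    _ ≤ C := by rw [mul_one]; exact hC k

lemma dot_integrable {X : Type*} [MeasurableSpace X] (μ : Measure X) {σ : ℕ}
    (p : X → Fin σ → ℝ) (hp : Measurable p) (P : ℝ) (hpb : ∀ x, ‖p x‖ ≤ P)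
    (a : X → Fin σ → ℝ) (ha : Integrable a μ) :
    Integrable (fun x => ∑ i, p x i * a x i) μ := by
  refine integrable_finsetSum _ fun i _ => ?_
  refine (Integrable.eval ha i).bdd_mul (c := P) ?_ ?_
  · exact ((measurable_pi_apply i).comp hp).aestronglyMeasurable
  · exact ae_of_all _ fun x => (norm_le_pi_norm (p x) i).trans (hpb x)

lemma bad_sets_tendsto {X : Type*} [MeasurableSpace X] (μ : Measure X) [IsFiniteMeasure μ]
    {s σ : ℕ} (Φ : X → (Fin s → ℝ) → (Fin σ → ℝ) → EReal)
    (hm : Measurable fun q : X × ((Fin s → ℝ) × (Fin σ → ℝ)) => Φ q.1 q.2.1 q.2.2)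
    (hcont : ∀ x, Continuous fun q : (Fin s → ℝ) × (Fin σ → ℝ) => Φ x q.1 q.2)
    (z : ℕ → X → Fin s → ℝ) (zlim : X → Fin s → ℝ) (hzm : ∀ k, Measurable (z k))
    (hzt : ∀ x, Tendsto (fun k => z k x) atTop (𝓝 (zlim x)))
    (a : ℕ → X → Fin σ → ℝ) (ham : ∀ k, Measurable (a k)) (ha : ∀ k, Integrable (a k) μ)
    (C : ℝ) (hC : ∀ k, ∫ x, ‖a k x‖ ∂μ ≤ C)
    (ε : ℝ) (hε : 0 < ε) (p : X → Fin σ → ℝ) (hp : Measurable p)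
    (c : X → ℝ) (hcm : Measurable c)
    (hmin : ∀ x b, ((∑ i, p x i * b i + c x - ε * ‖b‖ : ℝ) : EReal) ≤ Φ x (zlim x) b)
    (E : ℕ → Set X)
    (hE : ∀ k, E k = {x | Φ x (z k x) (a k x) <
      ((∑ i, p x i * a k x i + c x - ε * ‖a k x‖ - ε : ℝ) : EReal)}) :
    (∀ k, MeasurableSet (E k)) ∧ Tendsto (fun k => μ (E k)) atTop (𝓝 0) := by
  have hEm : ∀ k, MeasurableSet (E k) := by
    intro k
    rw [hE]
    apply measurableSet_lt
    · exact hm.comp (measurable_id.prodMk ((hzm k).prodMk (ham k)))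
    · apply Measurable.coe_real_ereal
      have := ham k
      fun_prop
  refine ⟨hEm, ?_⟩
  have key : ∀ R : ℝ, Tendsto (fun k => μ (E k ∩ {x | ‖a k x‖ ≤ R})) atTop (𝓝 0) := by
    intro R
    have := tendsto_measure_of_tendsto_indicator_of_isFiniteMeasure (L := atTop) (A := ∅)
      (As := fun k => E k ∩ {x | ‖a k x‖ ≤ R}) μ
      (fun k => (hEm k).inter (measurableSet_le (ham k).norm measurable_const)) ?_
    · simpa using this
    intro x
    by_contra hcon
    have hfr : ∃ᶠ k in atTop, x ∈ E k ∩ {x | ‖a k x‖ ≤ R} := by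
      refine (not_eventually.1 hcon).mono fun k hk => ?_
      simpa using hk
    obtain ⟨ψ, hψ, hψ2⟩ := extraction_of_frequently_atTop hfr
    obtain ⟨b, -, θ, hθ, hθ2⟩ := (isCompact_closedBall (0 : Fin σ → ℝ) R).tendsto_subseq
      (x := fun i => a (ψ i) x) (fun i => by
        rw [mem_closedBall_zero_iff]; exact (hψ2 i).2)
    have h1 : Tendsto (fun i => Φ x (z (ψ (θ i)) x) (a (ψ (θ i)) x)) atTop
        (𝓝 (Φ x (zlim x) b)) := by
      have h2 : Tendsto (fun i => (z (ψ (θ i)) x, a (ψ (θ i)) x)) atTop (𝓝 (zlim x, b)) :=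
        ((hzt x).comp (hψ.comp hθ).tendsto_atTop).prodMk_nhds hθ2
      exact ((hcont x).tendsto (zlim x, b)).comp h2
    have h3 : Tendsto (fun i => ((∑ j, p x j * a (ψ (θ i)) x j + c x - ε * ‖a (ψ (θ i)) x‖ - ε : ℝ)
        : EReal)) atTop (𝓝 ((∑ j, p x j * b j + c x - ε * ‖b‖ - ε : ℝ) : EReal)) := by
      have : Continuous fun b : Fin σ → ℝ =>
          ((∑ j, p x j * b j + c x - ε * ‖b‖ - ε : ℝ) : EReal) := by
        apply continuous_coe_real_ereal.comp
        fun_prop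
      exact (this.tendsto b).comp hθ2
    have h4 := le_of_tendsto_of_tendsto' h1 h3 fun i => by
      have := (hψ2 (θ i)).1
      rw [hE] at this
      exact le_of_lt this
    have h5 := (hmin x b).trans h4
    rw [EReal.coe_le_coe_iff] at h5
    linarith
  have hreal : Tendsto (fun k => μ.real (E k)) atTop (𝓝 0) := by
    rw [Metric.tendsto_atTop']
    intro δ hδ
    set R := 2 * (|C| + 1) / δ with hR
    have hRpos : 0 < R := by positivity
    have hk := (ENNReal.tendsto_toReal (by simp)).comp (key R)
    have hk2 := (Metric.tendsto_atTop'.1 hk) (δ / 2) (by positivity)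
    obtain ⟨N, hN⟩ := hk2
    refine ⟨N, fun k hkN => ?_⟩
    have h1 := hN k hkN
    simp only [Function.comp, ENNReal.toReal_zero, Real.dist_eq, sub_zero] at h1 ⊢
    rw [abs_of_nonneg ENNReal.toReal_nonneg] at h1
    rw [abs_of_nonneg measureReal_nonneg]
    have h2 := mul_meas_ge_le_integral_of_nonneg (μ := μ) (f := fun x => ‖a k x‖)
      (ae_of_all _ fun x => norm_nonneg _) (ha k).norm R
    have h3 : μ.real {x | R ≤ ‖a k x‖} < δ / 2 := by
      have h4 := h2.trans (hC k)
      by_contra hcon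
      push Not at hcon
      have : R * (δ / 2) ≤ C := (mul_le_mul_of_nonneg_left hcon hRpos.le).trans h4
      have h5 : R * (δ / 2) = |C| + 1 := by rw [hR]; field_simp
      linarith [le_abs_self C]
    have hsub : E k ⊆ (E k ∩ {x | ‖a k x‖ ≤ R}) ∪ {x | R ≤ ‖a k x‖} := by
      intro x hx
      rcases le_total (‖a k x‖) R with h | h
      · exact Or.inl ⟨hx, h⟩
      · exact Or.inr h
    calc μ.real (E k) ≤ _ := measureReal_mono hsub
      _ ≤ _ := measureReal_union_le _ _
      _ < δ / 2 + δ / 2 := add_lt_add h1 h3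
      _ = δ := by ring
  have := (ENNReal.tendsto_toReal_iff (f := fun k => μ (E k)) (x := 0)
    (fun k => measure_ne_top _ _) (by simp)).1 (by simpa [Measure.real] using hreal)
  exact this

lemma core {X : Type*} [MeasurableSpace X] (μ : Measure X) [IsFiniteMeasure μ]
    {s σ : ℕ} (Φ : X → (Fin s → ℝ) → (Fin σ → ℝ) → EReal)
    (hm : Measurable fun q : X × ((Fin s → ℝ) × (Fin σ → ℝ)) => Φ q.1 q.2.1 q.2.2)
    (hcont : ∀ x, Continuous fun q : (Fin s → ℝ) × (Fin σ → ℝ) => Φ x q.1 q.2)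
    (φ : X → ℝ) (hφi : Integrable φ μ) (hlb : ∀ x zz aa, (φ x : EReal) ≤ Φ x zz aa)
    (z : ℕ → X → Fin s → ℝ) (zlim : X → Fin s → ℝ) (hzm : ∀ k, Measurable (z k))
    (hzt : ∀ x, Tendsto (fun k => z k x) atTop (𝓝 (zlim x)))
    (a : ℕ → X → Fin σ → ℝ) (alim : X → Fin σ → ℝ)
    (ham : ∀ k, Measurable (a k)) (ha : ∀ k, Integrable (a k) μ) (halim : Integrable alim μ)
    (haw : ∀ g : X → (Fin σ → ℝ), AEStronglyMeasurable g μ →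
      (∃ C : ℝ, ∀ᵐ x ∂μ, ‖g x‖ ≤ C) →
      Tendsto (fun k => ∫ x, ∑ i, g x i * a k x i ∂μ) atTop
        (𝓝 (∫ x, ∑ i, g x i * alim x i ∂μ)))
    (C : ℝ) (hC : ∀ k, ∫ x, ‖a k x‖ ∂μ ≤ C)
    (ε : ℝ) (hε : 0 < ε) (p : X → Fin σ → ℝ) (hp : Measurable p)
    (P : ℝ) (hpb : ∀ x, ‖p x‖ ≤ P)
    (c : X → ℝ) (hcm : Measurable c) (hc : Integrable c μ)
    (hmin : ∀ x b, ((∑ i, p x i * b i + c x - ε * ‖b‖ : ℝ) : EReal) ≤ Φ x (zlim x) b)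
    (r : ℝ) (hr : ∃ᶠ k in atTop, eintegral μ (fun x => Φ x (z k x) (a k x)) < (r : EReal)) :
    ∫ x, (∑ i, p x i * alim x i + c x) ∂μ ≤ r + ε * (C + μ.real Set.univ) := by
  obtain ⟨E, hE⟩ : ∃ E : ℕ → Set X, ∀ k, E k = {x | Φ x (z k x) (a k x) <
      ((∑ i, p x i * a k x i + c x - ε * ‖a k x‖ - ε : ℝ) : EReal)} := ⟨_, fun _ => rfl⟩
  obtain ⟨hEm, hEt⟩ := bad_sets_tendsto μ Φ hm hcont z zlim hzm hzt a ham ha C hC ε hε p hp c hcm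
    hmin E hE
  obtain ⟨κ, hκ, hκ2⟩ := extraction_forall_of_frequently (P := fun n k =>
    eintegral μ (fun x => Φ x (z k x) (a k x)) < (r : EReal) ∧ μ (E k) ≤ (1 / 2 : ℝ≥0∞) ^ n)
    (fun n => hr.and_eventually (hEt.eventually (ge_mem_nhds (by
      apply ENNReal.pow_pos; simp))))
  set D : ℕ → Set X := fun j => ⋃ i, E (κ (i + j)) with hD
  have hDm : ∀ j, MeasurableSet (D j) := fun j => MeasurableSet.iUnion fun i => hEm _
  have hsum : ∑' i, μ (E (κ i)) ≠ ⊤ := by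
    refine ne_top_of_le_ne_top ?_ (ENNReal.tsum_le_tsum fun i => (hκ2 i).2)
    rw [ENNReal.tsum_geometric]
    simp
  have hDt : Tendsto (fun j => μ (D j)) atTop (𝓝 0) :=
    tendsto_of_tendsto_of_tendsto_of_le_of_le tendsto_const_nhds
      (ENNReal.tendsto_sum_nat_add (fun i => μ (E (κ i))) hsum) (fun _ => bot_le)
      (fun j => measure_iUnion_le _)
  set w : X → ℝ := fun x => ∑ i, p x i * alim x i + c x with hw
  have hwi : Integrable w μ := (dot_integrable μ p hp P hpb alim halim).add hc
  have hj : ∀ j, ∫ x in (D j)ᶜ, w x ∂μ + ∫ x in D j, φ x ∂μ ≤ r + ε * (C + μ.real Set.univ) := by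
    intro j
    have hlim : Tendsto (fun k => ∫ x in (D j)ᶜ, ∑ i, p x i * a k x i ∂μ) atTop
        (𝓝 (∫ x in (D j)ᶜ, ∑ i, p x i * alim x i ∂μ)) := by
      have h1 := haw ((D j)ᶜ.indicator p)
        (hp.indicator (hDm j).compl).aestronglyMeasurable
        ⟨P, ae_of_all _ fun x => (norm_indicator_le_norm_self _ _).trans (hpb x)⟩
      have h2 : ∀ f : X → Fin σ → ℝ, ∫ x, ∑ i, (D j)ᶜ.indicator p x i * f x i ∂μ =
          ∫ x in (D j)ᶜ, ∑ i, p x i * f x i ∂μ := by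
        intro f
        rw [← integral_indicator (hDm j).compl]
        congr 1
        funext x
        by_cases hx : x ∈ (D j)ᶜ
        · simp only [Set.indicator_of_mem hx]
        · simp only [Set.indicator_of_notMem hx]
          simp
      simpa only [h2] using h1
    have hlim2 := (hlim.comp hκ.tendsto_atTop).add_const
      (∫ x in (D j)ᶜ, c x ∂μ + ∫ x in D j, φ x ∂μ)
    have hsplit : ∫ x in (D j)ᶜ, w x ∂μ =
        ∫ x in (D j)ᶜ, ∑ i, p x i * alim x i ∂μ + ∫ x in (D j)ᶜ, c x ∂μ :=
      integral_add (dot_integrable μ p hp P hpb alim halim).integrableOn hc.integrableOn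
    rw [hsplit, add_assoc]
    refine le_of_tendsto hlim2 ?_
    filter_upwards [eventually_ge_atTop j] with i hij
    simp only [Function.comp]
    set k := κ i with hk
    have hdot := dot_integrable μ p hp P hpb (a k) (ha k)
    have hd1 : Integrable (fun x => ∑ i, p x i * a k x i + c x) μ := hdot.add hc
    have hd2 : Integrable (fun x => ∑ i, p x i * a k x i + c x - ε * ‖a k x‖) μ :=
      hd1.sub ((ha k).norm.const_mul ε)
    have hhi : Integrable (fun x => ∑ i, p x i * a k x i + c x - ε * ‖a k x‖ - ε) μ :=
      ((hdot.add hc).sub ((ha k).norm.const_mul ε)).sub (integrable_const ε)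
    have hle : (((∫ x, ((D j)ᶜ.indicator (fun x => ∑ i, p x i * a k x i + c x - ε * ‖a k x‖ - ε) x
        + (D j).indicator φ x) ∂μ : ℝ)) : EReal) ≤ eintegral μ (fun x => Φ x (z k x) (a k x)) := by
      rw [← eintegral_coe]
      · apply eintegral_mono
        intro x
        by_cases hx : x ∈ D j
        · rw [Set.indicator_of_notMem (by simpa using hx), Set.indicator_of_mem hx, zero_add]
          exact hlb _ _ _
        · rw [Set.indicator_of_mem (by simpa using hx), Set.indicator_of_notMem hx, add_zero]
          by_contra hcon
          push Not at hcon
          apply hx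
          refine Set.mem_iUnion.2 ⟨i - j, ?_⟩
          rw [Nat.sub_add_cancel hij, hE]
          exact hcon
      · exact (hhi.indicator (hDm j).compl).add (hφi.indicator (hDm j))
    have hlt := hle.trans_lt (hκ2 i).1
    rw [EReal.coe_lt_coe_iff, integral_add (hhi.indicator (hDm j).compl)
      (hφi.indicator (hDm j)), integral_indicator (hDm j).compl, integral_indicator (hDm j),
      integral_sub hd2.integrableOn
        (integrable_const ε).integrableOn,
      integral_sub hd1.integrableOn ((ha k).norm.const_mul ε).integrableOn,
      integral_add hdot.integrableOn hc.integrableOn, integral_const_mul, setIntegral_const,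
      smul_eq_mul] at hlt
    have h1 : ∫ x in (D j)ᶜ, ‖a k x‖ ∂μ ≤ C :=
      (setIntegral_le_integral (ha k).norm (ae_of_all _ fun x => norm_nonneg _)).trans (hC k)
    have h2 : μ.real (D j)ᶜ ≤ μ.real Set.univ := measureReal_mono (Set.subset_univ _)
    nlinarith [mul_le_mul_of_nonneg_left h1 hε.le, mul_le_mul_of_nonneg_left h2 hε.le]
  have h1 : ∀ j, ∫ x in (D j)ᶜ, w x ∂μ + ∫ x in D j, φ x ∂μ =
      ∫ x, w x ∂μ - ∫ x in D j, w x ∂μ + ∫ x in D j, φ x ∂μ := by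
    intro j
    rw [← integral_add_compl (hDm j) hwi]
    ring
  have h2 : Tendsto (fun j => ∫ x, w x ∂μ - ∫ x in D j, w x ∂μ + ∫ x in D j, φ x ∂μ) atTop
      (𝓝 (∫ x, w x ∂μ - 0 + 0)) :=
    (tendsto_const_nhds.sub (hwi.tendsto_setIntegral_nhds_zero hDt)).add
      (hφi.tendsto_setIntegral_nhds_zero hDt)
  have h3 := le_of_tendsto' h2 fun j => (h1 j) ▸ hj j
  simpa using h3

lemma rat_minorant {σ : ℕ} (f : (Fin σ → ℝ) → EReal) (hf : Continuous f)
    (hconv : ∀ (a₁ a₂ : Fin σ → ℝ), ∀ t ∈ Set.Icc (0:ℝ) 1,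
        f (t • a₁ + (1 - t) • a₂) ≤ (t : EReal) * f a₁ + ((1 - t : ℝ) : EReal) * f a₂)
    (φ : ℝ) (hφ : ∀ b, (φ : EReal) ≤ f b) (a : Fin σ → ℝ) (r : ℝ) (hr : (r : EReal) < f a)
    (ε : ℝ) (hε : 0 < ε) :
    ∃ (q : Fin σ → ℚ) (c : ℚ),
      (∀ b, ((∑ i, (q i : ℝ) * b i + (c : ℝ) - ε * ‖b‖ : ℝ) : EReal) ≤ f b) ∧
      r ≤ ∑ i, (q i : ℝ) * a i + (c : ℝ) := by
  obtain ⟨p, c, h1, h2⟩ := affine_minorant f hf hconv φ hφ a r hr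
  set d := ∑ i, p i * a i + c - r with hd
  have hd0 : 0 < d := by linarith
  set K : ℝ := σ * (‖a‖ + 1) + 1 with hK
  have hK0 : 0 < K := by positivity
  set η := min ε d / K with hη
  have hη0 : 0 < η := div_pos (lt_min hε hd0) hK0
  have hηK : η * K = min ε d := by rw [hη]; field_simp
  choose q hq1 hq2 using fun i => exists_rat_btwn (show p i - η < p i by linarith)
  obtain ⟨c', hc1, hc2⟩ := exists_rat_btwn (show c - η < c by linarith)
  have hdiff : ∀ b : Fin σ → ℝ,
      |∑ i, (q i : ℝ) * b i - ∑ i, p i * b i| ≤ η * σ * ‖b‖ := by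
    intro b
    rw [← Finset.sum_sub_distrib]
    refine (Finset.abs_sum_le_sum_abs _ _).trans ?_
    have : ∀ i ∈ Finset.univ, |(q i : ℝ) * b i - p i * b i| ≤ η * ‖b‖ := by
      intro i _
      rw [← sub_mul, abs_mul]
      have h3 : |(q i : ℝ) - p i| ≤ η := by
        rw [abs_le]; constructor <;> linarith [hq1 i, hq2 i]
      exact mul_le_mul h3 (norm_le_pi_norm b i) (abs_nonneg _) hη0.le
    refine (Finset.sum_le_sum this).trans ?_
    simp only [Finset.sum_const, Finset.card_univ, Fintype.card_fin, nsmul_eq_mul]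
    linarith
  have hσ : (0:ℝ) ≤ σ := Nat.cast_nonneg _
  have hna : 0 ≤ ‖a‖ := norm_nonneg _
  have hsa : 0 ≤ (σ:ℝ) * ‖a‖ := by positivity
  have hse : η * σ ≤ ε := by
    have : η * σ ≤ η * K := mul_le_mul_of_nonneg_left (by rw [hK]; linarith) hη0.le
    exact this.trans (hηK ▸ min_le_left _ _)
  refine ⟨q, c', fun b => le_trans ?_ (h1 b), ?_⟩
  · rw [EReal.coe_le_coe_iff]
    have h3 := (abs_le.1 (hdiff b)).2
    have h4 := mul_le_mul_of_nonneg_right hse (norm_nonneg b)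
    linarith
  · have h3 := (abs_le.1 (hdiff a)).1
    have h4 : η * (σ * ‖a‖ + 1) ≤ η * K := mul_le_mul_of_nonneg_left (by rw [hK]; linarith) hη0.le
    have h5 : η * K ≤ d := hηK ▸ min_le_right _ _
    nlinarith

lemma vseq_rep {X : Type*} [MeasurableSpace X] (μ : Measure X) [IsFiniteMeasure μ]
    {σ : ℕ} (f : X → (Fin σ → ℝ) → EReal)
    (φ : X → ℝ) (hφm : Measurable φ) (hφi : Integrable φ μ) (hlb : ∀ x b, (φ x : EReal) ≤ f x b)
    (alim : X → Fin σ → ℝ) (ham : Measurable alim) (ε : ℝ) (hε : 0 < ε)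
    (q : ℕ → Fin σ → ℝ) (d : ℕ → ℝ) (B : ℕ → Set X) (hBm : ∀ n, MeasurableSet (B n))
    (hB : ∀ n, ∀ x ∈ B n, ∀ b, ((∑ i, q n i * b i + d n - ε * ‖b‖ : ℝ) : EReal) ≤ f x b) :
    ∃ v : ℕ → X → ℝ, (∀ x, Monotone fun n => v n x) ∧
      (∀ n, ∀ x ∈ B n, ∑ i, q n i * alim x i + d n ≤ v (n + 1) x) ∧
      ∀ n, ∃ (p : X → Fin σ → ℝ) (P : ℝ) (c : X → ℝ), Measurable p ∧ (∀ x, ‖p x‖ ≤ P) ∧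
        Measurable c ∧ Integrable c μ ∧
        (∀ x b, ((∑ i, p x i * b i + c x - ε * ‖b‖ : ℝ) : EReal) ≤ f x b) ∧
        v n = fun x => ∑ i, p x i * alim x i + c x := by
  classical
  set v : ℕ → X → ℝ := fun n => Nat.rec φ (fun n w x =>
    if x ∈ B n ∧ w x ≤ ∑ i, q n i * alim x i + d n then ∑ i, q n i * alim x i + d n else w x) n
    with hv
  have hv0 : v 0 = φ := rfl
  have hvs : ∀ n x, v (n + 1) x = if x ∈ B n ∧ v n x ≤ ∑ i, q n i * alim x i + d n then
    ∑ i, q n i * alim x i + d n else v n x := fun n x => rfl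
  clear_value v
  refine ⟨v, fun x => monotone_nat_of_le_succ fun n => ?_, fun n x hx => ?_, fun n => ?_⟩
  · rw [hvs]
    split_ifs with h
    · exact h.2
    · exact le_rfl
  · rw [hvs]
    split_ifs with h
    · exact le_rfl
    · have := fun h' => h ⟨hx, h'⟩
      exact (not_le.1 this).le
  · induction n with
    | zero =>
      refine ⟨fun _ => 0, 0, φ, measurable_const, fun x => by simp, hφm, hφi, fun x b => ?_, ?_⟩
      · refine le_trans ?_ (hlb x b)
        rw [EReal.coe_le_coe_iff]
        have := mul_nonneg hε.le (norm_nonneg b)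
        simp
        linarith
      · rw [hv0]; funext x; simp
    | succ n ih =>
      obtain ⟨p, P, c, hp, hpb, hcm, hci, hmin, hvn⟩ := ih
      set S : Set X := B n ∩ {x | v n x ≤ ∑ i, q n i * alim x i + d n} with hS
      have hvm : Measurable (v n) := by rw [hvn]; fun_prop
      have hSm : MeasurableSet S := (hBm n).inter (measurableSet_le hvm (by fun_prop))
      refine ⟨S.piecewise (fun _ => q n) p, max P ‖q n‖, S.piecewise (fun _ => d n) c,
        Measurable.piecewise hSm measurable_const hp, fun x => ?_,
        Measurable.piecewise hSm measurable_const hcm,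
        Integrable.piecewise hSm (integrable_const _).integrableOn hci.integrableOn,
        fun x b => ?_, ?_⟩
      · by_cases hx : x ∈ S
        · rw [Set.piecewise_eq_of_mem _ _ _ hx]; exact le_max_right _ _
        · rw [Set.piecewise_eq_of_notMem _ _ _ hx]; exact (hpb x).trans (le_max_left _ _)
      · by_cases hx : x ∈ S
        · simp only [Set.piecewise_eq_of_mem _ _ _ hx]; exact hB n x hx.1 b
        · simp only [Set.piecewise_eq_of_notMem _ _ _ hx]; exact hmin x b
      · funext x
        rw [hvs]
        by_cases hx : x ∈ S
        · simp only [Set.piecewise_eq_of_mem _ _ _ hx]; rw [if_pos ⟨hx.1, hx.2⟩]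
        · simp only [Set.piecewise_eq_of_notMem _ _ _ hx]
          rw [if_neg (fun h => hx ⟨h.1, h.2⟩), hvn]

lemma clean {X : Type*} [MeasurableSpace X] (μ : Measure X) [IsFiniteMeasure μ]
    {s σ : ℕ} (Φ : X → (Fin s → ℝ) → (Fin σ → ℝ) → EReal)
    (hmeas : ∀ zz aa, Measurable fun x => Φ x zz aa)
    (hcont : ∀ x, Continuous fun q : (Fin s → ℝ) × (Fin σ → ℝ) => Φ x q.1 q.2)
    (hconv : ∀ x, ∀ (zz : Fin s → ℝ) (a₁ a₂ : Fin σ → ℝ),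
      ∀ t ∈ Set.Icc (0:ℝ) 1,
        Φ x zz (t • a₁ + (1 - t) • a₂) ≤
          (t : EReal) * Φ x zz a₁ + ((1 - t : ℝ) : EReal) * Φ x zz a₂)
    (φ : X → ℝ) (hφm : Measurable φ) (hφi : Integrable φ μ)
    (hlb : ∀ x zz aa, (φ x : EReal) ≤ Φ x zz aa)
    (z : ℕ → X → Fin s → ℝ) (zlim : X → Fin s → ℝ) (hzm : ∀ k, Measurable (z k))
    (hzt : ∀ x, Tendsto (fun k => z k x) atTop (𝓝 (zlim x)))
    (a : ℕ → X → Fin σ → ℝ) (alim : X → Fin σ → ℝ)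
    (ham : ∀ k, Measurable (a k)) (ha : ∀ k, Integrable (a k) μ)
    (halm : Measurable alim) (halim : Integrable alim μ)
    (haw : ∀ g : X → (Fin σ → ℝ), AEStronglyMeasurable g μ →
      (∃ C : ℝ, ∀ᵐ x ∂μ, ‖g x‖ ≤ C) →
      Tendsto (fun k => ∫ x, ∑ i, g x i * a k x i ∂μ) atTop
        (𝓝 (∫ x, ∑ i, g x i * alim x i ∂μ))) :
    eintegral μ (fun x => Φ x (zlim x) (alim x)) ≤
      Filter.liminf (fun k => eintegral μ (fun x => Φ x (z k x) (a k x))) atTop := by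
  have hm : Measurable fun q : X × ((Fin s → ℝ) × (Fin σ → ℝ)) => Φ q.1 q.2.1 q.2.2 := by
    have := measurable_uncurry_of_continuous_of_measurable
      (u := fun (q : (Fin s → ℝ) × (Fin σ → ℝ)) x => Φ x q.1 q.2) hcont
      (fun q => hmeas q.1 q.2)
    exact this.comp measurable_swap
  have hzlm : Measurable zlim := measurable_of_tendsto_metrizable hzm (tendsto_pi_nhds.2 hzt)
  obtain ⟨C, hC⟩ : ∃ C : ℝ, ∀ k, ∫ x, ‖a k x‖ ∂μ ≤ C := by
    have hi : ∀ i, ∃ C : ℝ, ∀ k, ∫ x, |a k x i| ∂μ ≤ C := by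
      intro i
      apply l1_bound μ (fun k x => a k x i) (fun k => Integrable.eval (ha k) i)
      rintro g hg ⟨C, hC⟩
      have := haw (fun x => Pi.single i (g x)) ?_ ⟨C, ?_⟩
      · have hsum : ∀ f : X → Fin σ → ℝ, ∀ x,
            ∑ j, (Pi.single i (g x) : Fin σ → ℝ) j * f x j = g x * f x i := by
          intro f x
          simp [Pi.single_apply]
        simp only [hsum] at this
        exact ⟨_, this⟩
      · have : Continuous fun y : ℝ => (Pi.single i y : Fin σ → ℝ) :=
          continuous_single (A := fun _ : Fin σ => ℝ) i
        exact this.comp_aestronglyMeasurable hg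
      · filter_upwards [hC] with x hx
        rw [Pi.norm_single]
        exact hx
    choose Ci hCi using hi
    refine ⟨∑ i, Ci i, fun k => ?_⟩
    calc ∫ x, ‖a k x‖ ∂μ ≤ ∫ x, ∑ i, |a k x i| ∂μ := by
          refine integral_mono (ha k).norm
            (integrable_finsetSum _ fun i _ => (Integrable.eval (ha k) i).abs) fun x => ?_
          refine (pi_norm_le_iff_of_nonneg (Finset.sum_nonneg fun i _ => abs_nonneg _)).2 fun i => ?_
          exact Finset.single_le_sum (f := fun i => |a k x i|) (fun i _ => abs_nonneg _)
            (Finset.mem_univ i)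
      _ = ∑ i, ∫ x, |a k x i| ∂μ :=
          integral_finsetSum _ fun i _ => (Integrable.eval (ha k) i).abs
      _ ≤ _ := Finset.sum_le_sum fun i _ => hCi i k
  have hC0 : 0 ≤ C := (integral_nonneg fun x => norm_nonneg _).trans (hC 0)
  -- it suffices to bound by reals above the liminf
  refine EReal.le_of_forall_lt_iff_le.1 fun r hr => ?_
  have hfr := frequently_lt_of_liminf_lt (by isBoundedDefault) hr
  refine EReal.le_of_forall_lt_iff_le.1 fun r' hr' => ?_
  rw [EReal.coe_lt_coe_iff] at hr'
  set ε := (r' - r) / (C + μ.real Set.univ + 1) with hεd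
  have hden : 0 < C + μ.real Set.univ + 1 := by positivity
  have hε : 0 < ε := div_pos (by linarith) hden
  have hεr : r + ε * (C + μ.real Set.univ) ≤ r' := by
    have : ε * (C + μ.real Set.univ + 1) = r' - r := by rw [hεd]; field_simp
    linarith
  obtain ⟨e, he⟩ := exists_surjective_nat ((Fin σ → ℚ) × ℚ)
  have hcb : ∀ x, Continuous (Φ x (zlim x)) := fun x =>
    (hcont x).comp (continuous_const.prodMk continuous_id)
  set B : ℕ → Set X := fun n => {x | ∀ b, ((∑ i, ((e n).1 i : ℝ) * b i + ((e n).2 : ℝ) - ε * ‖b‖ : ℝ)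
    : EReal) ≤ Φ x (zlim x) b} with hB
  have hBm : ∀ n, MeasurableSet (B n) := by
    intro n
    have : B n = ⋂ m : ℕ, {x | ((∑ i, ((e n).1 i : ℝ) * TopologicalSpace.denseSeq (Fin σ → ℝ) m i +
        ((e n).2 : ℝ) - ε * ‖TopologicalSpace.denseSeq (Fin σ → ℝ) m‖ : ℝ) : EReal) ≤
        Φ x (zlim x) (TopologicalSpace.denseSeq (Fin σ → ℝ) m)} := by
      ext x
      simp only [hB, Set.mem_ofPred_eq, Set.mem_iInter]
      refine ⟨fun h m => h _, fun h b => ?_⟩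
      refine (TopologicalSpace.denseRange_denseSeq (Fin σ → ℝ)).induction_on (p := fun b =>
        ((∑ i, ((e n).1 i : ℝ) * b i + ((e n).2 : ℝ) - ε * ‖b‖ : ℝ) : EReal) ≤ Φ x (zlim x) b)
        b ?_ h
      refine isClosed_le (continuous_coe_real_ereal.comp ?_) (hcb x)
      fun_prop
    rw [this]
    refine MeasurableSet.iInter fun m => measurableSet_le measurable_const ?_
    exact hm.comp (measurable_id.prodMk (hzlm.prodMk measurable_const))
  obtain ⟨v, hvmono, hvB, hvrep⟩ := vseq_rep μ (fun x => Φ x (zlim x)) φ hφm hφi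
    (fun x b => hlb x _ b) alim halm ε hε (fun n i => ((e n).1 i : ℝ)) (fun n => ((e n).2 : ℝ))
    B hBm (fun n x hx => hx)
  refine eintegral_le_of_monotone μ (u := v) ?_ ?_ hvmono ?_ ?_
  · intro n
    obtain ⟨p, P, c, hp, hpb, hcm, hci, hmin, hvn⟩ := hvrep n
    rw [hvn]; fun_prop
  · intro n
    obtain ⟨p, P, c, hp, hpb, hcm, hci, hmin, hvn⟩ := hvrep n
    rw [hvn]
    exact (dot_integrable μ p hp P hpb alim halim).add hci
  · intro x
    refine EReal.ge_of_forall_gt_iff_ge.1 fun t ht => ?_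
    obtain ⟨q, c, h1, h2⟩ := rat_minorant (Φ x (zlim x)) (hcb x) (hconv x (zlim x)) (φ x)
      (hlb x (zlim x)) (alim x) t ht ε hε
    obtain ⟨n, hn⟩ := he (q, c)
    have hxB : x ∈ B n := by
      simp only [hB, Set.mem_ofPred_eq, hn]
      exact h1
    have h3 := hvB n x hxB
    simp only [hn] at h3
    refine le_trans ?_ (le_iSup (fun n => (v n x : EReal)) (n + 1))
    exact EReal.coe_le_coe_iff.2 (h2.trans h3)
  · intro n
    obtain ⟨p, P, c, hp, hpb, hcm, hci, hmin, hvn⟩ := hvrep n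
    rw [hvn]
    exact (core μ Φ hm hcont φ hφi hlb z zlim hzm hzt a alim ham ha halim haw C hC ε hε p hp P hpb
      c hcm hci hmin r hfr).trans hεr

lemma eintegral_congr {α : Type*} [MeasurableSpace α] (μ : Measure α) {F G : α → EReal}
    (h : ∀ᵐ x ∂μ, F x = G x) : eintegral μ F = eintegral μ G := by
  unfold eintegral
  rw [lintegral_congr_ae (h.mono fun x hx => by simp only [hx] :
      (fun x => erealToENNReal (F x)) =ᵐ[μ] fun x => erealToENNReal (G x)),
    lintegral_congr_ae (h.mono fun x hx => by simp only [hx] :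
      (fun x => erealToENNReal (-F x)) =ᵐ[μ] fun x => erealToENNReal (-G x))]

lemma stmt_ae {X : Type*} [MeasurableSpace X] (μ : Measure X) [IsFiniteMeasure μ] {s σ : ℕ}
    (Φ : X → (Fin s → ℝ) → (Fin σ → ℝ) → EReal)
    (hmeas : ∀ (zz : Fin s → ℝ) (aa : Fin σ → ℝ), Measurable (fun x => Φ x zz aa))
    (hcont : ∀ᵐ x ∂μ,
      Continuous (fun q : (Fin s → ℝ) × (Fin σ → ℝ) => Φ x q.1 q.2))
    (hconv : ∀ᵐ x ∂μ, ∀ (zz : Fin s → ℝ) (a₁ a₂ : Fin σ → ℝ),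
      ∀ t ∈ Set.Icc (0:ℝ) 1,
        Φ x zz (t • a₁ + (1 - t) • a₂) ≤
          (t : EReal) * Φ x zz a₁ + ((1 - t : ℝ) : EReal) * Φ x zz a₂)
    (φ₀ : X → ℝ) (hφ₀ : Integrable φ₀ μ)
    (hlb : ∀ᵐ x ∂μ, ∀ zz aa, ((φ₀ x : ℝ) : EReal) ≤ Φ x zz aa)
    (z : ℕ → X → (Fin s → ℝ))
    (zlim : X → (Fin s → ℝ))
    (hz : ∀ k, Integrable (z k) μ)
    (hzae : ∀ᵐ x ∂μ, Tendsto (fun k => z k x) atTop (nhds (zlim x)))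
    (a : ℕ → X → (Fin σ → ℝ))
    (alim : X → (Fin σ → ℝ))
    (ha : ∀ k, Integrable (a k) μ) (halim : Integrable alim μ)
    (haw : ∀ g : X → (Fin σ → ℝ),
      AEStronglyMeasurable g μ →
      (∃ C : ℝ, ∀ᵐ x ∂μ, ‖g x‖ ≤ C) →
      Tendsto (fun k => ∫ x, ∑ i, g x i * a k x i ∂μ) atTop
        (nhds (∫ x, ∑ i, g x i * alim x i ∂μ))) :
    eintegral μ (fun x => Φ x (zlim x) (alim x)) ≤
      Filter.liminf (fun k => eintegral μ (fun x => Φ x (z k x) (a k x)))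
        Filter.atTop := by
  classical
  have hall : ∀ᵐ x ∂μ, (Continuous (fun q : (Fin s → ℝ) × (Fin σ → ℝ) => Φ x q.1 q.2)) ∧
      (∀ (zz : Fin s → ℝ) (a₁ a₂ : Fin σ → ℝ), ∀ t ∈ Set.Icc (0:ℝ) 1,
        Φ x zz (t • a₁ + (1 - t) • a₂) ≤
          (t : EReal) * Φ x zz a₁ + ((1 - t : ℝ) : EReal) * Φ x zz a₂) ∧
      (∀ zz aa, ((φ₀ x : ℝ) : EReal) ≤ Φ x zz aa) ∧
      Tendsto (fun k => z k x) atTop (nhds (zlim x)) ∧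
      (∀ k, z k x = (hz k).aemeasurable.mk (z k) x) ∧
      φ₀ x = hφ₀.aemeasurable.mk φ₀ x := by
    filter_upwards [hcont, hconv, hlb, hzae, ae_all_iff.2 fun k => (hz k).aemeasurable.ae_eq_mk,
      hφ₀.aemeasurable.ae_eq_mk] with x h1 h2 h3 h4 h5 h6
    exact ⟨h1, h2, h3, h4, h5, h6⟩
  obtain ⟨N, hNsub, hNm, hN0⟩ := exists_measurable_superset_of_null (ae_iff.1 hall)
  have hgood : ∀ x, x ∉ N → _ := fun x hx => by
    have := mt (@hNsub x) hx
    rw [Set.mem_ofPred_eq, not_not] at this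
    exact this
  have hNae : ∀ᵐ x ∂μ, x ∉ N := measure_eq_zero_iff_ae_notMem.1 hN0
  have haae : ∀ k, a k =ᵐ[μ] (ha k).aemeasurable.mk (a k) := fun k => (ha k).aemeasurable.ae_eq_mk
  have hlae : alim =ᵐ[μ] halim.aemeasurable.mk alim := halim.aemeasurable.ae_eq_mk
  have key := clean μ (fun x zz aa => if x ∈ N then 0 else Φ x zz aa) ?_ ?_ ?_
    (fun x => if x ∈ N then 0 else hφ₀.aemeasurable.mk φ₀ x) ?_ ?_ ?_
    (fun k x => if x ∈ N then 0 else (hz k).aemeasurable.mk (z k) x)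
    (fun x => if x ∈ N then 0 else zlim x) ?_ ?_
    (fun k => (ha k).aemeasurable.mk (a k)) (halim.aemeasurable.mk alim)
    (fun k => (ha k).aemeasurable.measurable_mk) (fun k => (ha k).congr (haae k))
    halim.aemeasurable.measurable_mk (halim.congr hlae) ?_
  · have e1 : eintegral μ (fun x => Φ x (zlim x) (alim x)) =
        eintegral μ (fun x => if x ∈ N then 0 else
          Φ x (if x ∈ N then 0 else zlim x) (halim.aemeasurable.mk alim x)) := by
      apply eintegral_congr
      filter_upwards [hNae, hlae] with x hx h1
      rw [if_neg hx, if_neg hx, ← h1]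
    have e2 : ∀ k, eintegral μ (fun x => Φ x (z k x) (a k x)) =
        eintegral μ (fun x => if x ∈ N then 0 else
          Φ x (if x ∈ N then 0 else (hz k).aemeasurable.mk (z k) x)
            ((ha k).aemeasurable.mk (a k) x)) := by
      intro k
      apply eintegral_congr
      filter_upwards [hNae, haae k] with x hx h1
      rw [if_neg hx, if_neg hx, ← h1, ← (hgood x hx).2.2.2.2.1 k]
    rw [e1]
    simp only [e2]
    exact key
  · exact fun zz aa => Measurable.ite hNm measurable_const (hmeas zz aa)
  · intro x
    by_cases hx : x ∈ N
    · simp only [if_pos hx]; exact continuous_const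
    · simp only [if_neg hx]; exact (hgood x hx).1
  · intro x
    by_cases hx : x ∈ N
    · simp [if_pos hx]
    · simp only [if_neg hx]; exact (hgood x hx).2.1
  · exact Measurable.ite hNm measurable_const hφ₀.aemeasurable.measurable_mk
  · refine hφ₀.congr ?_
    filter_upwards [hNae] with x hx
    rw [if_neg hx]; exact (hgood x hx).2.2.2.2.2
  · intro x zz aa
    by_cases hx : x ∈ N
    · simp [if_pos hx]
    · simp only [if_neg hx]
      rw [← (hgood x hx).2.2.2.2.2]
      exact (hgood x hx).2.2.1 zz aa
  · exact fun k => Measurable.ite hNm measurable_const (hz k).aemeasurable.measurable_mk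
  · intro x
    by_cases hx : x ∈ N
    · simp [if_pos hx]
    · simp only [if_neg hx, ← (hgood x hx).2.2.2.2.1]
      exact (hgood x hx).2.2.2.1
  · intro g hg hgb
    have := haw g hg hgb
    have e1 : ∫ x, ∑ i, g x i * alim x i ∂μ =
        ∫ x, ∑ i, g x i * halim.aemeasurable.mk alim x i ∂μ :=
      integral_congr_ae (hlae.mono fun x hx => by simp only [← hx])
    have e2 : ∀ k, ∫ x, ∑ i, g x i * a k x i ∂μ =
        ∫ x, ∑ i, g x i * (ha k).aemeasurable.mk (a k) x i ∂μ := fun k =>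
      integral_congr_ae ((haae k).mono fun x hx => by simp only [← hx])
    rw [e1] at this
    simp only [e2] at this
    exact this

/-- Eisen's weak lower semicontinuity theorem for convex integrands with values in
`ℝ ∪ {+∞}` (modeled by `EReal`, the value `⊥` being excluded via the lower bound):
if `Φ(·,z,a)` is measurable, `Φ(x,·,·)` is continuous for a.e. `x`, `Φ(x,z,·)` is convex,
`Φ ≥ φ₀` with `φ₀` integrable, `z_k → z` a.e. in `Ω` and `a_k ⇀ a` weakly in `L¹(Ω;ℝ^σ)`,
then `∫_Ω Φ(x,z,a) ≤ liminf_k ∫_Ω Φ(x,z_k,a_k)`. -/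
theorem stmt11 {n s σ : ℕ} (Ω : Set (EuclideanSpace ℝ (Fin n)))
    (hΩm : MeasurableSet Ω) (hΩb : Bornology.IsBounded Ω)
    (Φ : EuclideanSpace ℝ (Fin n) → (Fin s → ℝ) → (Fin σ → ℝ) → EReal)
    (hmeas : ∀ (zz : Fin s → ℝ) (aa : Fin σ → ℝ), Measurable (fun x => Φ x zz aa))
    (hcont : ∀ᵐ x ∂(volume.restrict Ω),
      Continuous (fun q : (Fin s → ℝ) × (Fin σ → ℝ) => Φ x q.1 q.2))
    (hconv : ∀ᵐ x ∂(volume.restrict Ω), ∀ (zz : Fin s → ℝ) (a₁ a₂ : Fin σ → ℝ),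
      ∀ t ∈ Set.Icc (0:ℝ) 1,
        Φ x zz (t • a₁ + (1 - t) • a₂) ≤
          (t : EReal) * Φ x zz a₁ + ((1 - t : ℝ) : EReal) * Φ x zz a₂)
    (φ₀ : EuclideanSpace ℝ (Fin n) → ℝ) (hφ₀ : IntegrableOn φ₀ Ω)
    (hlb : ∀ᵐ x ∂(volume.restrict Ω), ∀ zz aa, ((φ₀ x : ℝ) : EReal) ≤ Φ x zz aa)
    (z : ℕ → EuclideanSpace ℝ (Fin n) → (Fin s → ℝ))
    (zlim : EuclideanSpace ℝ (Fin n) → (Fin s → ℝ))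
    (hz : ∀ k, IntegrableOn (z k) Ω)
    (hzae : ∀ᵐ x ∂(volume.restrict Ω), Tendsto (fun k => z k x) atTop (nhds (zlim x)))
    (a : ℕ → EuclideanSpace ℝ (Fin n) → (Fin σ → ℝ))
    (alim : EuclideanSpace ℝ (Fin n) → (Fin σ → ℝ))
    (ha : ∀ k, IntegrableOn (a k) Ω) (halim : IntegrableOn alim Ω)
    (haw : ∀ g : EuclideanSpace ℝ (Fin n) → (Fin σ → ℝ),
      AEStronglyMeasurable g (volume.restrict Ω) →
      (∃ C : ℝ, ∀ᵐ x ∂(volume.restrict Ω), ‖g x‖ ≤ C) →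
      Tendsto (fun k => ∫ x in Ω, ∑ i, g x i * a k x i) atTop
        (nhds (∫ x in Ω, ∑ i, g x i * alim x i))) :
    eintegral (volume.restrict Ω) (fun x => Φ x (zlim x) (alim x)) ≤
      Filter.liminf (fun k => eintegral (volume.restrict Ω) (fun x => Φ x (z k x) (a k x)))
        Filter.atTop := by
  have : IsFiniteMeasure (volume.restrict Ω) := ⟨by
    rw [Measure.restrict_apply_univ]; exact hΩb.measure_lt_top⟩
  exact stmt_ae (volume.restrict Ω) Φ hmeas hcont hconv φ₀ hφ₀ hlb z zlim hz hzae a alim ha halim haw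
end
end
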